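/- Let f ∈ C⁰([0,∞)) ∩ C²((0,∞)) be nondecreasing and convex with f > 0 on (0,∞), assume q₀ = lim_{u→0⁺} q(u) exists with conjugate p₀, and set q̄_∞ = limsup_{u→+∞} q(u) with conjugate exponent p̲_∞ defined by 1/p̲_∞ + 1/q̄_∞ = 1. Let u ∈ C²(ℝ^N) be a nonnegative stable solution of −Δu = f(u) in ℝ^N (not assumed bounded). Then u ≡ 0 if either (1) 1 ≤ N ≤ 9 and 1 < p̲_∞, or (2) N = 10, p₀ < +∞ and 1 < p̲_∞ < +∞, or (3) N ≥ 11, p₀ < p_c(N) and 1 < p̲_∞ < p_c(N). -/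

import Mathlib

open MeasureTheory Filter Topology
open scoped ENNReal

/-- The Laplacian of `u : ℝ^N → ℝ`. -/
noncomputable def lap {N : ℕ} (u : EuclideanSpace ℝ (Fin N) → ℝ)
    (x : EuclideanSpace ℝ (Fin N)) : ℝ :=
  ∑ i : Fin N, iteratedFDeriv ℝ 2 u x ![EuclideanSpace.single i 1, EuclideanSpace.single i 1]

/-- `u` is a stable solution w.r.t. the linearized weight `g = f'`:
`∫ f'(u) φ² ≤ ∫ |∇φ|²` for all `φ ∈ C¹_c(ℝ^N)`. -/
def Stable {N : ℕ} (g : ℝ → ℝ) (u : EuclideanSpace ℝ (Fin N) → ℝ) : Prop :=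
  ∀ φ : EuclideanSpace ℝ (Fin N) → ℝ, ContDiff ℝ 1 φ → HasCompactSupport φ →
    ∫ x, g (u x) * (φ x) ^ 2 ≤ ∫ x, ‖gradient φ x‖ ^ 2

/-- `u` is stable outside the set `K` : the stability inequality holds for all
`φ ∈ C¹_c(ℝ^N \ K)`. -/
def StableOutside {N : ℕ} (g : ℝ → ℝ) (u : EuclideanSpace ℝ (Fin N) → ℝ)
    (K : Set (EuclideanSpace ℝ (Fin N))) : Prop :=
  ∀ φ : EuclideanSpace ℝ (Fin N) → ℝ, ContDiff ℝ 1 φ → HasCompactSupport φ →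
    tsupport φ ⊆ Kᶜ →
    ∫ x, g (u x) * (φ x) ^ 2 ≤ ∫ x, ‖gradient φ x‖ ^ 2

/-- The quantity `q(u) = f'(u)²/(f(u) f''(u)) ∈ [0,∞]`, with the convention
`q(u) = +∞` when `f(u) f''(u) = 0`. -/
noncomputable def qfun (f : ℝ → ℝ) (t : ℝ) : ℝ≥0∞ :=
  if f t * deriv (deriv f) t = 0 then ⊤
  else ENNReal.ofReal ((deriv f t) ^ 2 / (f t * deriv (deriv f) t))

/-- The Joseph–Lundgren exponent `p_c(N)` (for `N ≥ 11`). -/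
noncomputable def pc (N : ℕ) : ℝ :=
  (((N : ℝ) - 2) ^ 2 - 4 * N + 8 * Real.sqrt ((N : ℝ) - 1)) / (((N : ℝ) - 2) * ((N : ℝ) - 10))

/-- The `i`-th partial derivative. -/
noncomputable def pd {N : ℕ} (i : Fin N) (v : EuclideanSpace ℝ (Fin N) → ℝ)
    (x : EuclideanSpace ℝ (Fin N)) : ℝ :=
  fderiv ℝ v x (EuclideanSpace.single i 1)

theorem ContDiff.pd {N : ℕ} {n m : WithTop ℕ∞} {v : EuclideanSpace ℝ (Fin N) → ℝ} (hv : ContDiff ℝ n v)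
    (hmn : m + 1 ≤ n) (i : Fin N) : ContDiff ℝ m (pd i v) :=
  (hv.fderiv_right hmn).clm_apply contDiff_const

theorem HasCompactSupport.pd {N : ℕ} {v : EuclideanSpace ℝ (Fin N) → ℝ}
    (hv : HasCompactSupport v) (i : Fin N) : HasCompactSupport (pd i v) :=
  hv.fderiv_apply ℝ _

theorem lap_eq_sum_pd {N : ℕ} {u : EuclideanSpace ℝ (Fin N) → ℝ} (hu : ContDiff ℝ 2 u)
    (x : EuclideanSpace ℝ (Fin N)) : lap u x = ∑ i, pd i (pd i u) x := by
  unfold lap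
  refine Finset.sum_congr rfl fun i _ => ?_
  rw [iteratedFDeriv_two_apply]
  have h : DifferentiableAt ℝ (fderiv ℝ u) x :=
    ((hu.fderiv_right (m := 1) (by norm_num)).differentiable (by norm_num)).differentiableAt
  have : pd i u = fun y => fderiv ℝ u y (EuclideanSpace.single i 1) := rfl
  rw [pd, this, fderiv_clm_apply h (by fun_prop)]
  simp

theorem norm_gradient_sq {N : ℕ} (v : EuclideanSpace ℝ (Fin N) → ℝ)
    (x : EuclideanSpace ℝ (Fin N)) : ‖gradient v x‖ ^ 2 = ∑ i, pd i v x ^ 2 := by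
  rw [EuclideanSpace.norm_sq_eq]
  refine Finset.sum_congr rfl fun i _ => ?_
  have : pd i v x = gradient v x i := by
    rw [pd, ← InnerProductSpace.toDual_symm_apply (𝕜 := ℝ), EuclideanSpace.inner_single_right]
    simp [-InnerProductSpace.toDual_symm_apply, gradient]
  rw [this]; simp

theorem integral_pd_eq_zero {N : ℕ} {v : EuclideanSpace ℝ (Fin N) → ℝ} (hv : ContDiff ℝ 1 v)
    (hc : HasCompactSupport v) (i : Fin N) : ∫ x, pd i v x = 0 := by
  have := integral_mul_fderiv_eq_neg_fderiv_mul_of_integrable (μ := volume) (𝕜 := ℝ) (f := fun _ => (1 : ℝ))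
    (g := v) (v := EuclideanSpace.single i (1 : ℝ)) (by simp)
    (by
      have h := (hv.pd (m := 0) (by simp) i).continuous.integrable_of_hasCompactSupport
        (μ := volume) (hc.pd i)
      simp only [one_mul]
      exact h)
    (by simpa only [one_mul] using hv.continuous.integrable_of_hasCompactSupport (μ := volume) hc)
    (fun x _ => by fun_prop) fun x _ => hv.differentiable (by simp) x
  simpa [pd] using this

theorem pd_mul {N : ℕ} {v w : EuclideanSpace ℝ (Fin N) → ℝ} {x : EuclideanSpace ℝ (Fin N)}
    (hv : DifferentiableAt ℝ v x) (hw : DifferentiableAt ℝ w x) (i : Fin N) :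
    pd i (fun y => v y * w y) x = pd i v x * w x + v x * pd i w x := by
  simp only [pd]
  rw [fderiv_fun_mul hv hw]
  simp
  ring

theorem pd_comp {N : ℕ} {h : ℝ → ℝ} {h' : ℝ} {v : EuclideanSpace ℝ (Fin N) → ℝ}
    {x : EuclideanSpace ℝ (Fin N)} (hh : HasDerivAt h h' (v x)) (hv : DifferentiableAt ℝ v x)
    (i : Fin N) : pd i (fun y => h (v y)) x = h' * pd i v x := by
  have := (hh.comp_hasFDerivAt x hv.hasFDerivAt).fderiv
  simp only [pd]
  change fderiv ℝ (h ∘ v) x _ = _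
  rw [this]
  simp

theorem pd_add {N : ℕ} {v w : EuclideanSpace ℝ (Fin N) → ℝ} {x : EuclideanSpace ℝ (Fin N)}
    (hv : DifferentiableAt ℝ v x) (hw : DifferentiableAt ℝ w x) (i : Fin N) :
    pd i (fun y => v y + w y) x = pd i v x + pd i w x := by
  simp only [pd]
  rw [fderiv_fun_add hv hw]
  simp

/-- The divergence theorem for compactly supported `C¹` vector fields. -/
theorem integral_sum_pd_eq_zero {N : ℕ} {F : Fin N → EuclideanSpace ℝ (Fin N) → ℝ}
    (hF : ∀ i, ContDiff ℝ 1 (F i)) (hc : ∀ i, HasCompactSupport (F i)) :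
    ∫ x, ∑ i, pd i (F i) x = 0 := by
  rw [integral_finsetSum]
  · exact Finset.sum_eq_zero fun i _ => integral_pd_eq_zero (hF i) (hc i) i
  · exact fun i _ => ((hF i).pd (m := 0) (by simp) i).continuous.integrable_of_hasCompactSupport
      ((hc i).pd i)

theorem contDiff_one_of_hasDerivAt {h h' : ℝ → ℝ} (hh : ∀ t, HasDerivAt h (h' t) t)
    (hc : Continuous h') : ContDiff ℝ 1 h := by
  rw [contDiff_one_iff_deriv]
  refine ⟨fun t => (hh t).differentiableAt, ?_⟩
  rwa [show deriv h = h' from funext fun t => (hh t).deriv]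

theorem hasCompactSupport_sum {α ι : Type*} [TopologicalSpace α] {s : Finset ι}
    {F : ι → α → ℝ} (h : ∀ i, HasCompactSupport (F i)) :
    HasCompactSupport fun x => ∑ i ∈ s, F i x := by
  classical
  induction s using Finset.induction_on with
  | empty =>
    simp only [Finset.sum_empty]
    exact HasCompactSupport.zero
  | insert i s hi ih =>
    simp only [Finset.sum_insert hi]
    exact (h i).add ih

/-- The integrated form of the divergence identity for the field
`ψ(u) χ ∇u + H(u) ∇χ`, where `-Δu = f(u)`. -/
theorem integral_divergence_identity {N : ℕ} {f ψ ψ' H H' : ℝ → ℝ}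
    {u χ : EuclideanSpace ℝ (Fin N) → ℝ}
    (hu : ContDiff ℝ 2 u) (hsol : ∀ x, -lap u x = f (u x))
    (hψ : ∀ t, HasDerivAt ψ (ψ' t) t) (hψ' : Continuous ψ')
    (hH : ∀ t, HasDerivAt H (H' t) t) (hH' : Continuous H')
    (hχ : ContDiff ℝ 2 χ) (hχc : HasCompactSupport χ) :
    ∫ x, (ψ' (u x) * (∑ i, pd i u x ^ 2) * χ x +
      (ψ (u x) + H' (u x)) * (∑ i, pd i u x * pd i χ x) - f (u x) * ψ (u x) * χ x +
      H (u x) * ∑ i, pd i (pd i χ) x) = 0 := by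
  have hu1 : ContDiff ℝ 1 u := hu.of_le (by norm_num)
  have hχ1 : ContDiff ℝ 1 χ := hχ.of_le (by norm_num)
  have hpu : ∀ i, ContDiff ℝ 1 (pd i u) := fun i => hu.pd (by norm_num) i
  have hpχ : ∀ i, ContDiff ℝ 1 (pd i χ) := fun i => hχ.pd (by norm_num) i
  have hψu : ContDiff ℝ 1 fun x => ψ (u x) := (contDiff_one_of_hasDerivAt hψ hψ').comp hu1
  have hHu : ContDiff ℝ 1 fun x => H (u x) := (contDiff_one_of_hasDerivAt hH hH').comp hu1
  rw [← integral_sum_pd_eq_zero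
    (F := fun i x => (ψ (u x) * χ x) * pd i u x + H (u x) * pd i χ x)
    (fun i => ((hψu.mul hχ1).mul (hpu i)).add (hHu.mul (hpχ i)))
    (fun i => (hχc.mul_left.mul_right).add ((hχc.pd i).mul_left))]
  congr 1
  ext x
  have hd {v : EuclideanSpace ℝ (Fin N) → ℝ} (hv : ContDiff ℝ 1 v) : DifferentiableAt ℝ v x :=
    hv.differentiable (by simp) x
  rw [← hsol, lap_eq_sum_pd hu]
  have : ∀ i, pd i (fun x => (ψ (u x) * χ x) * pd i u x + H (u x) * pd i χ x) x =
      ψ' (u x) * χ x * pd i u x ^ 2 + (ψ (u x) + H' (u x)) * (pd i u x * pd i χ x) +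
        ψ (u x) * χ x * pd i (pd i u) x + H (u x) * pd i (pd i χ) x := by
    intro i
    rw [pd_add (hd ((hψu.mul hχ1).mul (hpu i))) (hd (hHu.mul (hpχ i))),
      pd_mul (hd (hψu.mul hχ1)) (hd (hpu i)), pd_mul (hd hHu) (hd (hpχ i)),
      pd_mul (hd hψu) (hd hχ1), pd_comp (hψ _) (hd hu1), pd_comp (hH _) (hd hu1)]
    ring
  simp_rw [this, Finset.sum_add_distrib, ← Finset.mul_sum]
  ring

/-- Testing the equation against a cutoff. -/
theorem integral_solution_le {N : ℕ} {f : ℝ → ℝ} {u : EuclideanSpace ℝ (Fin N) → ℝ}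
    (hu : ContDiff ℝ 2 u) (hnonneg : ∀ x, 0 ≤ u x) (hsol : ∀ x, -lap u x = f (u x))
    {ζ : EuclideanSpace ℝ (Fin N) → ℝ} (hζ : ContDiff ℝ 2 ζ) (hζc : HasCompactSupport ζ) :
    ∫ x, f (u x) * ζ x ^ 2 ≤
      ∫ x, u x * (∑ i, pd i ζ x ^ 2 + |∑ i, pd i (pd i fun y => ζ y ^ 2) x|) := by
  have hχ : ContDiff ℝ 2 fun y => ζ y ^ 2 := hζ.pow 2
  have hχc : HasCompactSupport fun y => ζ y ^ 2 :=
    hζc.comp_left (g := fun t : ℝ => t ^ 2) (by simp)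
  have key := integral_divergence_identity (ψ := fun _ => 1) (ψ' := fun _ => 0)
    (H := fun t => -t) (H' := fun _ => -1) hu hsol (fun t => hasDerivAt_const _ _)
    continuous_const (fun t => hasDerivAt_neg t) continuous_const hχ hχc
  set χ : EuclideanSpace ℝ (Fin N) → ℝ := fun y => ζ y ^ 2 with hχdef
  have hppχ : ∀ i, Continuous (pd i (pd i χ)) := fun i =>
    ((hχ.pd (m := 1) (by norm_num) i).pd (m := 0) (by simp) i).continuous
  have hppu : ∀ i, Continuous (pd i (pd i u)) := fun i =>
    ((hu.pd (m := 1) (by norm_num) i).pd (m := 0) (by simp) i).continuous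
  have hpζ : ∀ i, Continuous (pd i ζ) := fun i => (hζ.pd (m := 1) (by norm_num) i).continuous
  have huc := hu.continuous
  have hfu : Continuous fun x => f (u x) := by
    simp_rw [← hsol, lap_eq_sum_pd hu]; fun_prop
  have hsumc : HasCompactSupport fun x => ∑ i, pd i (pd i χ) x :=
    hasCompactSupport_sum fun i => (hχc.pd i).pd i
  have hsumc' : HasCompactSupport fun x => ∑ i, pd i ζ x ^ 2 :=
    hasCompactSupport_sum fun i => (hζc.pd i).comp_left (g := fun t : ℝ => t ^ 2) (by simp)
  have h1 : Integrable fun x => f (u x) * χ x :=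
    (hfu.mul hχ.continuous).integrable_of_hasCompactSupport hχc.mul_left
  have h2 : Integrable fun x => -(u x * ∑ i, pd i (pd i χ) x) :=
    (Continuous.integrable_of_hasCompactSupport (by fun_prop) hsumc.mul_left).neg
  have : ∫ x, f (u x) * χ x = ∫ x, -(u x * ∑ i, pd i (pd i χ) x) := by
    rw [← sub_eq_zero, ← integral_sub h1 h2, ← neg_eq_zero, ← integral_neg, ← key]
    congr 1
    ext x
    ring
  rw [this]
  refine integral_mono h2 (Continuous.integrable_of_hasCompactSupport (by fun_prop) ?_)
    fun x => ?_
  · exact (hsumc'.add (hsumc.comp_left (g := fun t : ℝ => |t|) (by simp))).mul_left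
  · have h1 := neg_abs_le (∑ i, pd i (pd i χ) x)
    have h2 : 0 ≤ ∑ i, pd i ζ x ^ 2 := Finset.sum_nonneg fun i _ => sq_nonneg _
    have := mul_le_mul_of_nonneg_left (show -(∑ i, pd i (pd i χ) x) ≤
      ∑ i, pd i ζ x ^ 2 + |∑ i, pd i (pd i χ) x| by linarith) (hnonneg x)
    simp only
    linarith

/-- Testing stability against `φ(u) ζ` and the equation against `ψ(u) ζ²`, `ψ' = φ'²`. -/
theorem integral_stable_le {N : ℕ} {f g : ℝ → ℝ} {u : EuclideanSpace ℝ (Fin N) → ℝ}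
    (hu : ContDiff ℝ 2 u) (hsol : ∀ x, -lap u x = f (u x)) (hstab : Stable g u)
    {φ φ' ψ H : ℝ → ℝ} {c : ℝ} (hφ : ∀ t, HasDerivAt φ (φ' t) t) (hφ' : Continuous φ')
    (hψ : ∀ t, HasDerivAt ψ (φ' t ^ 2) t) (hH : ∀ t, HasDerivAt H (φ t * φ' t - ψ t) t)
    (hg : Continuous fun x => g (u x) * φ (u x) ^ 2)
    (hc : ∀ x, f (u x) * ψ (u x) ≤ (1 - c) * (g (u x) * φ (u x) ^ 2))
    (hHb : ∀ x, |H (u x)| ≤ φ (u x) ^ 2)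
    {ζ : EuclideanSpace ℝ (Fin N) → ℝ} (hζ : ContDiff ℝ 2 ζ) (hζc : HasCompactSupport ζ) :
    c * ∫ x, g (u x) * φ (u x) ^ 2 * ζ x ^ 2 ≤
      ∫ x, φ (u x) ^ 2 * (∑ i, pd i ζ x ^ 2 + |∑ i, pd i (pd i fun y => ζ y ^ 2) x|) := by
  obtain ⟨χ, hχdef⟩ : ∃ χ, χ = fun y => ζ y ^ 2 := ⟨_, rfl⟩
  have hχval : ∀ x, ζ x ^ 2 = χ x := fun x => by rw [hχdef]
  have hχ : ContDiff ℝ 2 χ := hχdef ▸ hζ.pow 2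
  have hχc : HasCompactSupport χ := hχdef ▸ hζc.comp_left (g := fun t : ℝ => t ^ 2) (by simp)
  rw [← hχdef]
  simp_rw [hχval]
  have hφc : ContDiff ℝ 1 φ := contDiff_one_of_hasDerivAt hφ hφ'
  have hψc : ContDiff ℝ 1 ψ := contDiff_one_of_hasDerivAt hψ (hφ'.pow 2)
  have hHc : ContDiff ℝ 1 H :=
    contDiff_one_of_hasDerivAt hH ((hφc.continuous.mul hφ').sub hψc.continuous)
  have hu1 : ContDiff ℝ 1 u := hu.of_le (by norm_num)
  have hζ1 : ContDiff ℝ 1 ζ := hζ.of_le (by norm_num)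
  have key := integral_divergence_identity hu hsol hψ (hφ'.pow 2) hH
    ((hφc.continuous.mul hφ').sub hψc.continuous) hχ hχc
  have hst := hstab (fun x => φ (u x) * ζ x) ((hφc.comp hu1).mul hζ1) hζc.mul_left
  have hpχ : ∀ i x, pd i χ x = 2 * ζ x * pd i ζ x := fun i x => by
    have := pd_comp (h := fun t => t ^ 2) (v := ζ) (hasDerivAt_pow 2 (ζ x))
      (hζ1.differentiable (by simp) x) i
    simpa [hχdef] using this
  have hppχ : ∀ i, Continuous (pd i (pd i χ)) := fun i =>
    ((hχ.pd (m := 1) (by norm_num) i).pd (m := 0) (by simp) i).continuous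
  have hppu : ∀ i, Continuous (pd i (pd i u)) := fun i =>
    ((hu.pd (m := 1) (by norm_num) i).pd (m := 0) (by simp) i).continuous
  have hpζ : ∀ i, Continuous (pd i ζ) := fun i => (hζ.pd (m := 1) (by norm_num) i).continuous
  have hpu : ∀ i, Continuous (pd i u) := fun i => (hu.pd (m := 1) (by norm_num) i).continuous
  have huc := hu.continuous
  have hζcont := hζ.continuous
  have hφcont := hφc.continuous
  have hψcont := hψc.continuous
  have hHcont := hHc.continuous
  have hfu : Continuous fun x => f (u x) := by
    simp_rw [← hsol, lap_eq_sum_pd hu]; fun_prop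
  have hsumc : HasCompactSupport fun x => ∑ i, pd i (pd i χ) x :=
    hasCompactSupport_sum fun i => (hχc.pd i).pd i
  have hsumc' : HasCompactSupport fun x => ∑ i, pd i ζ x ^ 2 :=
    hasCompactSupport_sum fun i => (hζc.pd i).comp_left (g := fun t : ℝ => t ^ 2) (by simp)
  have hgrad : ∀ x, ‖gradient (fun x => φ (u x) * ζ x) x‖ ^ 2 =
      φ' (u x) ^ 2 * (∑ i, pd i u x ^ 2) * χ x +
        φ (u x) * φ' (u x) * (∑ i, pd i u x * pd i χ x) +
        φ (u x) ^ 2 * ∑ i, pd i ζ x ^ 2 := by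
    intro x
    rw [norm_gradient_sq, mul_assoc, Finset.sum_mul, Finset.mul_sum, Finset.mul_sum,
      Finset.mul_sum, ← Finset.sum_add_distrib, ← Finset.sum_add_distrib]
    refine Finset.sum_congr rfl fun i _ => ?_
    rw [pd_mul (v := fun x => φ (u x)) ((hφc.comp hu1).differentiable (by simp) x) (hζ1.differentiable (by simp) x),
      pd_comp (hφ _) (hu1.differentiable (by simp) x), hpχ]
    rw [← hχval]
    ring
  simp_rw [hgrad] at hst
  have i1 : Integrable fun x => f (u x) * ψ (u x) * χ x :=
    ((hfu.mul (hψcont.comp huc)).mul hχ.continuous).integrable_of_hasCompactSupport hχc.mul_left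
  have i2 : Integrable fun x => H (u x) * ∑ i, pd i (pd i χ) x :=
    Continuous.integrable_of_hasCompactSupport (by fun_prop) hsumc.mul_left
  have i3 : Integrable fun x => φ (u x) ^ 2 * ∑ i, pd i ζ x ^ 2 :=
    Continuous.integrable_of_hasCompactSupport (by fun_prop) hsumc'.mul_left
  have i4 : Integrable fun x => g (u x) * φ (u x) ^ 2 * χ x :=
    Continuous.integrable_of_hasCompactSupport (by fun_prop) hχc.mul_left
  have i5 : Integrable fun x => φ (u x) ^ 2 *
      (∑ i, pd i ζ x ^ 2 + |∑ i, pd i (pd i χ) x|) :=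
    Continuous.integrable_of_hasCompactSupport (by fun_prop)
      (hsumc'.add (hsumc.comp_left (g := fun t : ℝ => |t|) (by simp))).mul_left
  have e1 : ∀ x, φ' (u x) ^ 2 * (∑ i, pd i u x ^ 2) * χ x +
        φ (u x) * φ' (u x) * (∑ i, pd i u x * pd i χ x) +
        φ (u x) ^ 2 * ∑ i, pd i ζ x ^ 2 =
      (φ' (u x) ^ 2 * (∑ i, pd i u x ^ 2) * χ x +
        (ψ (u x) + (φ (u x) * φ' (u x) - ψ (u x))) * (∑ i, pd i u x * pd i χ x) -
        f (u x) * ψ (u x) * χ x + H (u x) * ∑ i, pd i (pd i χ) x) +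
      (f (u x) * ψ (u x) * χ x - H (u x) * ∑ i, pd i (pd i χ) x +
        φ (u x) ^ 2 * ∑ i, pd i ζ x ^ 2) := fun x => by ring
  have i6 : Integrable fun x => (φ' (u x) ^ 2 * (∑ i, pd i u x ^ 2) * χ x +
        (ψ (u x) + (φ (u x) * φ' (u x) - ψ (u x))) * (∑ i, pd i u x * pd i χ x) -
        f (u x) * ψ (u x) * χ x + H (u x) * ∑ i, pd i (pd i χ) x) := by
    refine Continuous.integrable_of_hasCompactSupport ?_
      (((hχc.mul_left.add ?_).sub hχc.mul_left).add hsumc.mul_left)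
    · simp_rw [hpχ]
      refine Continuous.add (Continuous.sub (by fun_prop) ?_) (by fun_prop)
      exact (hfu.mul (hψcont.comp huc)).mul hχ.continuous
    · exact HasCompactSupport.mul_left (hasCompactSupport_sum fun i => (hχc.pd i).mul_left)
  have i7 : Integrable fun x => f (u x) * ψ (u x) * χ x - H (u x) * ∑ i, pd i (pd i χ) x +
      φ (u x) ^ 2 * ∑ i, pd i ζ x ^ 2 := (i1.sub i2).add i3
  simp_rw [e1] at hst
  rw [integral_add i6 i7, key, zero_add] at hst
  have hfin : ∫ x, c * (g (u x) * φ (u x) ^ 2 * χ x) ≤ ∫ x, (g (u x) * φ (u x) ^ 2 * χ x -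
      (f (u x) * ψ (u x) * χ x - H (u x) * ∑ i, pd i (pd i χ) x +
        φ (u x) ^ 2 * ∑ i, pd i ζ x ^ 2) + φ (u x) ^ 2 *
      (∑ i, pd i ζ x ^ 2 + |∑ i, pd i (pd i χ) x|)) := by
    refine integral_mono (i4.const_mul c) ((i4.sub i7).add i5) fun x => ?_
    have h1 := mul_le_mul_of_nonneg_right (hc x) (sq_nonneg (ζ x))
    rw [hχval] at h1
    have h2 : -(H (u x) * ∑ i, pd i (pd i χ) x) ≤ φ (u x) ^ 2 * |∑ i, pd i (pd i χ) x| := by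
      refine (neg_le_abs _).trans ?_
      rw [abs_mul]
      exact mul_le_mul_of_nonneg_right (hHb x) (abs_nonneg _)
    simp only
    linarith
  have i8 : Integrable fun x => g (u x) * φ (u x) ^ 2 * χ x -
      (f (u x) * ψ (u x) * χ x - H (u x) * ∑ i, pd i (pd i χ) x +
        φ (u x) ^ 2 * ∑ i, pd i ζ x ^ 2) := i4.sub i7
  rw [integral_add i8 i5,
    integral_sub i4 i7, integral_const_mul] at hfin
  simp_rw [mul_pow, hχval, ← mul_assoc] at hst
  linarith

theorem pd_comp_smul {N : ℕ} {v : EuclideanSpace ℝ (Fin N) → ℝ} (hv : Differentiable ℝ v)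
    (a : ℝ) (i : Fin N) (x : EuclideanSpace ℝ (Fin N)) :
    pd i (fun y => v (a • y)) x = a * pd i v (a • x) := by
  simp only [pd]
  have := (((hv (a • x)).hasFDerivAt).comp x ((hasFDerivAt_id x).const_smul a)).fderiv
  change fderiv ℝ (v ∘ HSMul.hSMul a) x _ = _
  rw [this]
  simp

theorem pd_const_mul {N : ℕ} {v : EuclideanSpace ℝ (Fin N) → ℝ} (hv : Differentiable ℝ v)
    (a : ℝ) (i : Fin N) (x : EuclideanSpace ℝ (Fin N)) :
    pd i (fun y => a * v y) x = a * pd i v x := by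
  rw [pd_mul (differentiableAt_const _) (hv x)]
  simp [pd]

theorem pd_pow {N : ℕ} {v : EuclideanSpace ℝ (Fin N) → ℝ} (hv : Differentiable ℝ v)
    (n : ℕ) (i : Fin N) (x : EuclideanSpace ℝ (Fin N)) :
    pd i (fun y => v y ^ n) x = n * v x ^ (n - 1) * pd i v x :=
  pd_comp (h := fun t => t ^ n) (hasDerivAt_pow n (v x)) (hv x) i

theorem exists_abs_le_of_hasCompactSupport {N : ℕ} {v : EuclideanSpace ℝ (Fin N) → ℝ}
    (hv : Continuous v) (hc : HasCompactSupport v) : ∃ C, 0 ≤ C ∧ ∀ x, |v x| ≤ C := by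
  obtain ⟨C, hC⟩ := hv.bounded_above_of_compact_support hc
  exact ⟨C, (norm_nonneg _).trans (hC 0), hC⟩

/-- Powers of rescaled cutoffs and the bounds on their derivatives. -/
theorem exists_cutoff (N m : ℕ) : ∃ C : ℝ, 0 < C ∧ ∀ R : ℝ, 0 < R →
    ∃ η : EuclideanSpace ℝ (Fin N) → ℝ, ContDiff ℝ 2 η ∧ HasCompactSupport η ∧
      (∀ x, 0 ≤ η x) ∧ (∀ x, η x ≤ 1) ∧ (∀ x, ‖x‖ ≤ R → η x = 1) ∧
      (∀ x, 2 * R ≤ ‖x‖ → η x = 0) ∧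
      ∀ x, ∑ i, pd i (fun y => η y ^ (m + 1)) x ^ 2 +
        |∑ i, pd i (pd i fun y => (η y ^ (m + 1)) ^ 2) x| ≤ C * R⁻¹ ^ 2 * η x ^ (2 * m) := by
  let B : ContDiffBump (0 : EuclideanSpace ℝ (Fin N)) := ⟨1, 2, by norm_num, by norm_num⟩
  have hBs : ContDiff ℝ 2 B := B.contDiff
  have hBc : HasCompactSupport B := B.hasCompactSupport
  have hBd : Differentiable ℝ B := hBs.differentiable (by simp)
  have hp1 : ∀ i, ContDiff ℝ 1 (pd i B) := fun i => hBs.pd (by norm_num) i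
  have hp2 : ∀ i, ContDiff ℝ 0 (pd i (pd i B)) := fun i => (hp1 i).pd (by simp) i
  choose C₁ hC₁ hb₁ using fun i => exists_abs_le_of_hasCompactSupport (hp1 i).continuous (hBc.pd i)
  choose C₂ hC₂ hb₂ using fun i =>
    exists_abs_le_of_hasCompactSupport (hp2 i).continuous ((hBc.pd i).pd i)
  set n : ℕ := 2 * m + 2 with hn
  refine ⟨1 + ∑ i, ((m + 1 : ℝ) ^ 2 * C₁ i ^ 2 + ((n * (n - 1) : ℝ) * C₁ i ^ 2 + n * C₂ i)),
    add_pos_of_pos_of_nonneg one_pos (Finset.sum_nonneg fun i _ => ?_), fun R hR => ?_⟩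
  · have := hC₂ i
    have h1 : (1 : ℝ) ≤ n := by rw [hn]; push_cast; linarith [(Nat.cast_nonneg m : (0 : ℝ) ≤ m)]
    have : (0 : ℝ) ≤ n - 1 := by linarith
    positivity
  refine ⟨fun x => B (R⁻¹ • x), hBs.comp (contDiff_const_smul _), ?_, fun x => B.nonneg,
    fun x => B.le_one, fun x hx => ?_, fun x hx => ?_, fun x => ?_⟩
  · exact hBc.comp_homeomorph (Homeomorph.smulOfNeZero R⁻¹ (inv_ne_zero hR.ne'))
  · apply B.one_of_mem_closedBall
    simp only [mem_closedBall_zero_iff, norm_smul, norm_inv, Real.norm_eq_abs, abs_of_pos hR]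
    change R⁻¹ * ‖x‖ ≤ 1
    rw [inv_mul_le_iff₀ hR]
    linarith
  · apply B.zero_of_le_dist
    simp only [dist_zero_right, norm_smul, norm_inv, Real.norm_eq_abs, abs_of_pos hR]
    change 2 ≤ R⁻¹ * ‖x‖
    rw [le_inv_mul_iff₀ hR]
    linarith
  · set y := R⁻¹ • x with hy
    have hη0 : 0 ≤ B y := B.nonneg
    have hη1 : B y ≤ 1 := B.le_one
    have e1 : ∀ i, pd i (fun z => B (R⁻¹ • z) ^ (m + 1)) x =
        R⁻¹ * ((m + 1) * B y ^ m * pd i B y) := fun i => by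
      rw [pd_comp_smul (v := fun z => B z ^ (m + 1)) (hBd.pow _), pd_pow hBd]
      simp [hy]
    have e2 : ∀ i, pd i (pd i fun z => (B (R⁻¹ • z) ^ (m + 1)) ^ 2) x =
        R⁻¹ ^ 2 * ((n * (n - 1)) * B y ^ (2 * m) * pd i B y ^ 2 +
          n * B y ^ (2 * m + 1) * pd i (pd i B) y) := fun i => by
      have f1 : (pd i fun z => (B (R⁻¹ • z) ^ (m + 1)) ^ 2) =
          fun z => (fun w => R⁻¹ * (fun w => n * (fun w => (fun a => B a ^ (2 * m + 1)) w *
            pd i B w) w) w) (R⁻¹ • z) := by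
        ext z
        simp_rw [← pow_mul]
        rw [pd_comp_smul (v := fun z => B z ^ ((m + 1) * 2)) (hBd.pow _), pd_pow hBd,
          show (m + 1) * 2 = n by rw [hn]; ring, show n - 1 = 2 * m + 1 by omega]
        ring
      have d1 : Differentiable ℝ fun w => (fun a => B a ^ (2 * m + 1)) w * pd i B w :=
        (hBd.pow _).mul ((hp1 i).differentiable (by simp))
      rw [f1, pd_comp_smul ((d1.const_mul _).const_mul _), pd_const_mul (d1.const_mul _),
        pd_const_mul d1,
        pd_mul (v := fun a => B a ^ (2 * m + 1)) (hBd.pow _ _) ((hp1 i).differentiable (by simp) _), pd_pow hBd]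
      simp only [hn]
      push_cast
      simp
      ring
    simp_rw [e1, e2]
    have hpow : B y ^ (2 * m + 1) ≤ B y ^ (2 * m) := pow_le_pow_of_le_one hη0 hη1 (by omega)
    have hR2 : 0 ≤ R⁻¹ ^ 2 * B y ^ (2 * m) := by positivity
    have h1n : (0 : ℝ) ≤ n - 1 := by
      rw [hn]; push_cast; linarith [(Nat.cast_nonneg m : (0 : ℝ) ≤ m)]
    have hsq : ∀ i, pd i B y ^ 2 ≤ C₁ i ^ 2 := fun i => by
      rw [← sq_abs]; exact pow_le_pow_left₀ (abs_nonneg _) (hb₁ i y) 2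
    calc _ ≤ ∑ i, (R⁻¹ * ((m + 1) * B y ^ m * pd i B y)) ^ 2 + ∑ i, |R⁻¹ ^ 2 *
          ((n * (n - 1)) * B y ^ (2 * m) * pd i B y ^ 2 +
          n * B y ^ (2 * m + 1) * pd i (pd i B) y)| := by
          gcongr; exact Finset.abs_sum_le_sum_abs _ _
      _ ≤ ∑ i, (R⁻¹ ^ 2 * B y ^ (2 * m)) * ((m + 1 : ℝ) ^ 2 * C₁ i ^ 2 +
          ((n * (n - 1) : ℝ) * C₁ i ^ 2 + n * C₂ i)) := by
          rw [← Finset.sum_add_distrib]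
          refine Finset.sum_le_sum fun i _ => ?_
          rw [mul_add (R⁻¹ ^ 2 * B y ^ (2 * m))]
          refine add_le_add ?_ ?_
          · have hm1 : (0 : ℝ) ≤ ((m : ℝ) + 1) ^ 2 := by positivity
            calc _ = (R⁻¹ ^ 2 * B y ^ (2 * m)) * ((m + 1 : ℝ) ^ 2 * pd i B y ^ 2) := by ring
              _ ≤ _ := mul_le_mul_of_nonneg_left (mul_le_mul_of_nonneg_left (hsq i) hm1) hR2
          · rw [abs_mul, abs_of_nonneg (show (0 : ℝ) ≤ R⁻¹ ^ 2 by positivity),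
              mul_assoc (R⁻¹ ^ 2) (B y ^ (2 * m))]
            refine mul_le_mul_of_nonneg_left ?_ (show (0 : ℝ) ≤ R⁻¹ ^ 2 by positivity)
            refine (abs_add_le _ _).trans ?_
            rw [mul_add]
            refine add_le_add ?_ ?_
            · rw [abs_of_nonneg (show (0 : ℝ) ≤ n * (n - 1) * B y ^ (2 * m) * pd i B y ^ 2 by positivity)]
              calc _ = B y ^ (2 * m) * ((n * (n - 1)) * pd i B y ^ 2) := by ring
                _ ≤ _ := mul_le_mul_of_nonneg_left
                  (mul_le_mul_of_nonneg_left (hsq i) (by positivity)) (by positivity)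
            · rw [abs_mul, abs_of_nonneg (show (0 : ℝ) ≤ (n : ℝ) * B y ^ (2 * m + 1) by positivity)]
              calc _ ≤ n * B y ^ (2 * m) * C₂ i :=
                    mul_le_mul (by gcongr) (hb₂ i y) (abs_nonneg _) (by positivity)
                _ = _ := by ring
      _ ≤ _ := by
          rw [← Finset.mul_sum]
          nlinarith

/-- Pointwise absorption of the cutoff error. -/
theorem absorb_cutoff_error {a b k K L γ γ' η ρ : ℝ} {m : ℕ} (ha : 0 ≤ a) (hk : 0 ≤ k)
    (hγ0 : 0 ≤ γ) (hγγ' : γ ≤ γ') (hm0 : m ≠ 0) (hm : γ' ≤ m) (hK : 0 ≤ K) (hL : 0 < L)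
    (hpt : a = 0 ∨ (0 ≤ b ∧ a * b ≤ k ∧ a ≤ K * (b ^ γ + b ^ γ')))
    (hη0 : 0 ≤ η) (hη1 : η ≤ 1) (hρ0 : 0 < ρ) (hρ1 : ρ ≤ 1) :
    a * (ρ * η ^ (2 * m)) ≤
      L⁻¹ * (k * (η ^ (m + 1)) ^ 2) + K * (L ^ γ + L ^ γ') * (ρ ^ γ * ρ) := by
  have hR : 0 ≤ K * (L ^ γ + L ^ γ') * (ρ ^ γ * ρ) := by positivity
  have hkη : 0 ≤ L⁻¹ * (k * (η ^ (m + 1)) ^ 2) := by positivity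
  rcases hpt with h | ⟨hb, hab, hapt⟩
  · rw [h]; linarith
  rcases le_or_gt (L * ρ) (b * η ^ 2) with h | h
  · have : a * (ρ * η ^ (2 * m)) ≤ L⁻¹ * (k * (η ^ (m + 1)) ^ 2) := by
      rw [le_inv_mul_iff₀ hL]
      calc L * (a * (ρ * η ^ (2 * m))) = a * η ^ (2 * m) * (L * ρ) := by ring
        _ ≤ a * η ^ (2 * m) * (b * η ^ 2) := by gcongr
        _ = a * b * (η ^ (m + 1)) ^ 2 := by ring
        _ ≤ _ := by gcongr
    linarith
  · have hpow : ∀ s : ℝ, 0 ≤ s → s ≤ m → b ^ s * η ^ (2 * m) ≤ L ^ s * ρ ^ s := by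
      intro s hs hsm
      rcases hη0.eq_or_lt with h0 | h0
      · rw [← h0, zero_pow (by omega), mul_zero]; positivity
      calc b ^ s * η ^ (2 * m) ≤ b ^ s * (η ^ 2) ^ s := by
            gcongr
            rw [pow_mul, ← Real.rpow_natCast (η ^ 2) m]
            exact Real.rpow_le_rpow_of_exponent_ge (by positivity) (pow_le_one₀ hη0 hη1) hsm
        _ = (b * η ^ 2) ^ s := (Real.mul_rpow hb (by positivity)).symm
        _ ≤ (L * ρ) ^ s := Real.rpow_le_rpow (by positivity) h.le hs
        _ = _ := Real.mul_rpow hL.le hρ0.le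
    have h1 := hpow γ hγ0 (hγγ'.trans hm)
    have h2 := hpow γ' (hγ0.trans hγγ') hm
    have h3 : ρ ^ γ' ≤ ρ ^ γ := Real.rpow_le_rpow_of_exponent_ge hρ0 hρ1 hγγ'
    have h4 : L ^ γ' * ρ ^ γ' ≤ L ^ γ' * ρ ^ γ := by gcongr
    calc a * (ρ * η ^ (2 * m)) ≤ (K * (b ^ γ + b ^ γ')) * (ρ * η ^ (2 * m)) := by gcongr
      _ = K * (b ^ γ * η ^ (2 * m) + b ^ γ' * η ^ (2 * m)) * ρ := by ring
      _ ≤ K * (L ^ γ * ρ ^ γ + L ^ γ' * ρ ^ γ) * ρ :=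
          mul_le_mul_of_nonneg_right
            (mul_le_mul_of_nonneg_left (add_le_add h1 (h2.trans h4)) hK) hρ0.le
      _ = K * (L ^ γ + L ^ γ') * (ρ ^ γ * ρ) := by ring
      _ ≤ _ := by linarith

/-- A Liouville principle: a cutoff estimate with subcritical scaling forces `k = 0`. -/
theorem eq_zero_of_cutoff_estimate {N : ℕ} {a b k : EuclideanSpace ℝ (Fin N) → ℝ}
    (ha : Continuous a) (hk : Continuous k) (ha0 : ∀ x, 0 ≤ a x) (hk0 : ∀ x, 0 ≤ k x)
    {γ γ' K C₀ : ℝ} (hγ : (N : ℝ) < 2 * γ + 2) (hγ0 : 0 ≤ γ) (hγγ' : γ ≤ γ') (hK : 0 ≤ K)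
    (hpt : ∀ x, a x = 0 ∨ (0 ≤ b x ∧ a x * b x ≤ k x ∧ a x ≤ K * (b x ^ γ + b x ^ γ')))
    (hC₀ : 0 ≤ C₀)
    (hint : ∀ ζ : EuclideanSpace ℝ (Fin N) → ℝ, ContDiff ℝ 2 ζ → HasCompactSupport ζ →
      ∫ x, k x * ζ x ^ 2 ≤ C₀ * ∫ x, a x *
        (∑ i, pd i ζ x ^ 2 + |∑ i, pd i (pd i fun y => ζ y ^ 2) x|)) :
    ∀ x, k x = 0 := by
  obtain ⟨m, hm⟩ := exists_nat_ge (max γ' 1)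
  have hm1 : γ' ≤ m := (le_max_left _ _).trans hm
  have hm0 : m ≠ 0 := by
    rintro rfl
    have := (le_max_right γ' 1).trans hm
    norm_num at this
  obtain ⟨C, hC, hcut⟩ := exists_cutoff N m
  set D := C₀ * C with hD
  have hD0 : 0 ≤ D := by positivity
  set L := 2 * D + 1 with hL
  have hL0 : 0 < L := by positivity
  set V := volume.real (Metric.ball (0 : EuclideanSpace ℝ (Fin N)) 1) with hV
  set M := 2 * (D * (K * (L ^ γ + L ^ γ')) * (2 ^ N * V)) with hM
  have key : ∀ R : ℝ, 1 ≤ R → ∃ η : EuclideanSpace ℝ (Fin N) → ℝ, Continuous η ∧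
      HasCompactSupport η ∧ (∀ x, ‖x‖ ≤ R → η x = 1) ∧
      (∀ x, 2 * R ≤ ‖x‖ → η x = 0) ∧ (∀ x, η x ≤ 1) ∧ (∀ x, 0 ≤ η x) ∧
      ∫ x, k x * η x ^ 2 ≤ M * R ^ (-(2 * γ + 2 - N)) := by
    intro R hR
    have hR0 : 0 < R := by linarith
    obtain ⟨η, hη, hηc, hη0, hη1, hηR, hη2R, hηd⟩ := hcut R hR0
    set ρ := R⁻¹ ^ 2 with hρ
    have hρ0 : 0 < ρ := by positivity
    have hρ1 : ρ ≤ 1 := pow_le_one₀ (by positivity) (inv_le_one_of_one_le₀ hR)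
    have hζc : HasCompactSupport fun x => η x ^ (m + 1) :=
      hηc.comp_left (g := fun t : ℝ => t ^ (m + 1)) (by simp)
    refine ⟨fun x => η x ^ (m + 1), hη.continuous.pow _, hζc,
      fun x hx => by simp [hηR x hx], fun x hx => by simp [hη2R x hx],
      fun x => pow_le_one₀ (hη0 x) (hη1 x), fun x => pow_nonneg (hη0 x) _, ?_⟩
    have hηcont := hη.continuous
    have hζ2c : HasCompactSupport fun x => (η x ^ (m + 1)) ^ 2 :=
      hζc.comp_left (g := fun t : ℝ => t ^ 2) (by simp)
    have hη2mc : HasCompactSupport fun x => η x ^ (2 * m) :=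
      hηc.comp_left (g := fun t : ℝ => t ^ (2 * m)) (by simp [hm0])
    have iI : Integrable fun x => k x * (η x ^ (m + 1)) ^ 2 :=
      Continuous.integrable_of_hasCompactSupport (by fun_prop) hζ2c.mul_left
    have iA : Integrable fun x => a x * (ρ * η x ^ (2 * m)) :=
      Continuous.integrable_of_hasCompactSupport (by fun_prop) hη2mc.mul_left.mul_left
    have h1 := hint _ (hη.pow (m + 1)) hζc
    set Kc := K * (L ^ γ + L ^ γ') * (ρ ^ γ * ρ) with hKc
    have hKc0 : 0 ≤ Kc := by positivity
    set S := Metric.closedBall (0 : EuclideanSpace ℝ (Fin N)) (2 * R) with hS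
    have hSvol : volume.real S = 2 ^ N * R ^ N * V := by
      rw [hS, Measure.addHaar_real_closedBall _ _ (by positivity)]
      simp [hV, mul_pow]
    have iS : Integrable (S.indicator fun _ => Kc) :=
      (integrableOn_const (by exact measure_closedBall_lt_top.ne)).integrable_indicator
        measurableSet_closedBall
    have h2 : ∫ x, a x * (∑ i, pd i (fun x => η x ^ (m + 1)) x ^ 2 +
        |∑ i, pd i (pd i fun y => (η y ^ (m + 1)) ^ 2) x|) ≤
        C * ∫ x, a x * (ρ * η x ^ (2 * m)) := by
      rw [← integral_const_mul]
      refine integral_mono_of_nonneg (Eventually.of_forall fun x => ?_) (iA.const_mul C)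
        (Eventually.of_forall fun x => ?_)
      · exact mul_nonneg (ha0 x)
          (add_nonneg (Finset.sum_nonneg fun i _ => sq_nonneg _) (abs_nonneg _))
      · refine (mul_le_mul_of_nonneg_left (hηd x) (ha0 x)).trans_eq ?_
        ring
    have h3 : ∫ x, a x * (ρ * η x ^ (2 * m)) ≤
        ∫ x, (L⁻¹ * (k x * (η x ^ (m + 1)) ^ 2) + S.indicator (fun _ => Kc) x) := by
      refine integral_mono iA ((iI.const_mul _).add iS) fun x => ?_
      by_cases hx : x ∈ S
      · simp only [Set.indicator_of_mem hx]
        exact absorb_cutoff_error (ha0 x) (hk0 x) hγ0 hγγ' hm0 hm1 hK hL0 (hpt x) (hη0 x)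
          (hη1 x) hρ0 hρ1
      · have : η x = 0 := hη2R x (by simp [hS] at hx; exact hx.le)
        simp [this, hx, hm0]
    rw [integral_add (iI.const_mul _) iS, integral_const_mul,
      integral_indicator_const _ measurableSet_closedBall, hSvol, smul_eq_mul] at h3
    set I := ∫ x, k x * (η x ^ (m + 1)) ^ 2 with hI
    have hI0 : 0 ≤ I := integral_nonneg fun x => mul_nonneg (hk0 x) (sq_nonneg _)
    have h4 : I ≤ D * (L⁻¹ * I + 2 ^ N * R ^ N * V * Kc) :=
      calc I ≤ C₀ * (C * ∫ x, a x * (ρ * η x ^ (2 * m))) :=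
            h1.trans (mul_le_mul_of_nonneg_left h2 hC₀)
        _ ≤ C₀ * (C * (L⁻¹ * I + 2 ^ N * R ^ N * V * Kc)) := by gcongr
        _ = _ := by ring
    have h5 : D * L⁻¹ ≤ 1 / 2 := by
      rw [← div_eq_mul_inv, div_le_iff₀ hL0]; linarith
    have h6 : I ≤ 2 * (D * (2 ^ N * R ^ N * V * Kc)) := by nlinarith
    refine h6.trans_eq ?_
    have h7 : R ^ N * (ρ ^ γ * ρ) = R ^ (-(2 * γ + 2 - N)) := by
      rw [hρ, inv_pow, Real.inv_rpow (by positivity), ← Real.rpow_natCast R N,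
        ← Real.rpow_natCast R 2, ← Real.rpow_mul hR0.le, ← Real.rpow_neg hR0.le,
        ← Real.rpow_neg hR0.le, ← Real.rpow_add hR0, ← Real.rpow_add hR0]
      congr 1
      push_cast
      ring
    rw [← h7, hKc, hM]
    ring
  intro x
  by_contra hx
  have hkx : 0 < k x := lt_of_le_of_ne (hk0 x) (Ne.symm hx)
  obtain ⟨η₁, hη₁, hη₁c, hη₁R, hη₁2R, hη₁1, hη₁0, -⟩ := key (‖x‖ + 1) (by linarith [norm_nonneg x])
  have hcs : HasCompactSupport fun y => k y * η₁ y ^ 2 :=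
    (hη₁c.comp_left (g := fun t : ℝ => t ^ 2) (by simp)).mul_left
  have hJ : 0 < ∫ y, k y * η₁ y ^ 2 := by
    refine Continuous.integral_pos_of_hasCompactSupport_nonneg_nonzero (x := x) (by fun_prop) hcs
      (fun y => mul_nonneg (hk0 y) (sq_nonneg _)) ?_
    rw [hη₁R x (by linarith)]
    simpa using hx
  have hlim : Tendsto (fun R : ℝ => M * R ^ (-(2 * γ + 2 - N))) atTop (𝓝 0) := by
    simpa using (tendsto_rpow_neg_atTop (by linarith : 0 < 2 * γ + 2 - (N : ℝ))).const_mul M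
  obtain ⟨R, hRJ, hRx⟩ := ((hlim.eventually (gt_mem_nhds hJ)).and
    (eventually_ge_atTop (2 * (‖x‖ + 1)))).exists
  obtain ⟨η, hη, hηc, hηR, hη2R, hη1, hη0, hle⟩ := key R (by linarith [norm_nonneg x])
  refine absurd (hle.trans_lt hRJ) (not_lt.mpr ?_)
  refine integral_mono (Continuous.integrable_of_hasCompactSupport (by fun_prop) hcs)
    (Continuous.integrable_of_hasCompactSupport (by fun_prop)
      (hηc.comp_left (g := fun t : ℝ => t ^ 2) (by simp)).mul_left) fun y => ?_
  rcases le_total (2 * (‖x‖ + 1)) ‖y‖ with hy | hy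
  · simp only [hη₁2R y hy]
    have := mul_nonneg (hk0 y) (sq_nonneg (η y))
    simpa using this
  · simp only [hηR y (hy.trans hRx)]
    exact mul_le_mul_of_nonneg_left (pow_le_pow_left₀ (hη₁0 y) (hη₁1 y) 2) (hk0 y)

section RealVariable

variable {f g h : ℝ → ℝ}

theorem hasDerivAt_mul_rpow {q t : ℝ} (hf : HasDerivAt f (g t) t) (hg : HasDerivAt g (h t) t)
    (hft : 0 < f t) :
    HasDerivAt (fun t => g t * f t ^ (-(1 / q)))
      (f t ^ (-(1 / q) - 1) * (f t * h t - g t ^ 2 / q)) t := by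
  refine (hg.mul (hf.rpow_const (p := -(1 / q)) (Or.inl hft.ne'))).congr_deriv ?_
  have : f t ^ (-(1 / q)) = f t ^ (-(1 / q) - 1) * f t := by
    rw [Real.rpow_sub_one hft.ne']; field_simp
  rw [this]
  ring

theorem monotoneOn_of_hasDerivAt_nonneg {D : Set ℝ} (hD : Convex ℝ D) {F F' : ℝ → ℝ}
    (hF : ∀ t ∈ D, HasDerivAt F (F' t) t) (h0 : ∀ t ∈ D, 0 ≤ F' t) : MonotoneOn F D :=
  monotoneOn_of_hasDerivWithinAt_nonneg hD (fun t ht => (hF t ht).continuousAt.continuousWithinAt)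
    (fun t ht => (hF t (interior_subset ht)).hasDerivWithinAt)
    fun t ht => h0 t (interior_subset ht)

/-- Lower bound of the derivative by a power, when `g² ≤ Q f h` on `[M, ∞)`. -/
theorem exists_rpow_le_deriv_atTop {M Q : ℝ} (hM : 0 < M) (hQ : 0 < Q)
    (hf : ∀ t, 0 < t → HasDerivAt f (g t) t) (hg : ∀ t, 0 < t → HasDerivAt g (h t) t)
    (hfpos : ∀ t, 0 < t → 0 < f t) (hgM : 0 < g M)
    (hq : ∀ t, M ≤ t → g t ^ 2 ≤ Q * (f t * h t)) :
    ∃ c, 0 < c ∧ ∀ t, M ≤ t → c * f t ^ (1 / Q) ≤ g t := by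
  refine ⟨g M * f M ^ (-(1 / Q)), mul_pos hgM (Real.rpow_pos_of_pos (hfpos M hM) _), ?_⟩
  intro t ht
  have ht0 : 0 < t := hM.trans_le ht
  have hmono : MonotoneOn (fun t => g t * f t ^ (-(1 / Q))) (Set.Ici M) :=
    monotoneOn_of_hasDerivAt_nonneg (convex_Ici M)
      (fun s hs => hasDerivAt_mul_rpow (hf s (hM.trans_le hs)) (hg s (hM.trans_le hs))
        (hfpos s (hM.trans_le hs)))
      fun s hs => mul_nonneg (Real.rpow_nonneg (hfpos s (hM.trans_le hs)).le _) (by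
        rw [sub_nonneg, div_le_iff₀ hQ]; linarith [hq s hs])
  have := hmono (Set.mem_Ici.2 le_rfl) (Set.mem_Ici.2 ht) ht
  calc _ ≤ g t * f t ^ (-(1 / Q)) * f t ^ (1 / Q) :=
        mul_le_mul_of_nonneg_right this (Real.rpow_nonneg (hfpos t ht0).le _)
    _ = g t := by
        rw [mul_assoc, ← Real.rpow_add (hfpos t ht0)]; simp

/-- Lower bound of the derivative by a power, when `q f h ≤ g²` on `(0, s]`. -/
theorem exists_rpow_le_deriv_zero {s q : ℝ} (hs : 0 < s) (hq0 : 0 < q)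
    (hf : ∀ t, 0 < t → HasDerivAt f (g t) t) (hg : ∀ t, 0 < t → HasDerivAt g (h t) t)
    (hfpos : ∀ t, 0 < t → 0 < f t) (hgs : 0 < g s)
    (hq : ∀ t, 0 < t → t ≤ s → q * (f t * h t) ≤ g t ^ 2) :
    ∃ c, 0 < c ∧ ∀ t, 0 < t → t ≤ s → c * f t ^ (1 / q) ≤ g t := by
  refine ⟨g s * f s ^ (-(1 / q)), mul_pos hgs (Real.rpow_pos_of_pos (hfpos s hs) _), ?_⟩
  intro t ht0 ht
  have hmono : MonotoneOn (fun t => -(g t * f t ^ (-(1 / q)))) (Set.Ioc 0 s) :=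
    monotoneOn_of_hasDerivAt_nonneg (convex_Ioc 0 s)
      (fun r hr => (hasDerivAt_mul_rpow (hf r hr.1) (hg r hr.1) (hfpos r hr.1)).neg)
      fun r hr => by
        rw [neg_nonneg]
        refine mul_nonpos_of_nonneg_of_nonpos (Real.rpow_nonneg (hfpos r hr.1).le _) ?_
        rw [sub_nonpos, le_div_iff₀ hq0]; linarith [hq r hr.1 hr.2]
  have := neg_le_neg_iff.1 (hmono ⟨ht0, ht⟩ ⟨hs, le_rfl⟩ ht)
  calc _ ≤ g t * f t ^ (-(1 / q)) * f t ^ (1 / q) :=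
        mul_le_mul_of_nonneg_right this (Real.rpow_nonneg (hfpos t ht0).le _)
    _ = g t := by
        rw [mul_assoc, ← Real.rpow_add (hfpos t ht0)]; simp

/-- Integrated form of `c f^{1/q} ≤ g`. -/
theorem mul_sub_le_rpow_sub_rpow {c q s t : ℝ} (hq : 1 < q) (hs : 0 < s) (hst : s ≤ t)
    (hf : ∀ t, 0 < t → HasDerivAt f (g t) t) (hfpos : ∀ t, 0 < t → 0 < f t)
    (hc : ∀ r, s ≤ r → r ≤ t → c * f r ^ (1 / q) ≤ g r) :
    (1 - 1 / q) * c * (t - s) ≤ f t ^ (1 - 1 / q) - f s ^ (1 - 1 / q) := by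
  have hq1 : 0 ≤ 1 - 1 / q := by
    rw [sub_nonneg, div_le_one (by linarith)]; exact hq.le
  have hmono : MonotoneOn (fun r => f r ^ (1 - 1 / q) - (1 - 1 / q) * c * r) (Set.Icc s t) := by
    refine monotoneOn_of_hasDerivAt_nonneg (convex_Icc s t)
      (fun r hr => ((hf r (hs.trans_le hr.1)).rpow_const (p := 1 - 1 / q)
        (Or.inl (hfpos r (hs.trans_le hr.1)).ne')).sub ((hasDerivAt_id r).const_mul _)) ?_
    intro r hr
    have hfr := hfpos r (hs.trans_le hr.1)
    have h1 := mul_le_mul_of_nonneg_right (hc r hr.1 hr.2)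
      (Real.rpow_nonneg hfr.le (-(1 / q)))
    rw [mul_assoc, ← Real.rpow_add hfr, add_neg_cancel, Real.rpow_zero] at h1
    rw [show 1 - 1 / q - 1 = -(1 / q) by ring]
    nlinarith
  have := hmono ⟨le_rfl, hst⟩ ⟨hst, le_rfl⟩ hst
  simp only at this
  linarith

theorem exists_le_mul_div_rpow {c q : ℝ} (hq : 1 < q) (hc : 0 < c) :
    ∃ C, 0 ≤ C ∧ ∀ t v : ℝ, 0 < t → 0 < v → c * t ≤ v ^ (1 - 1 / q) →
      t ≤ C * (v / t) ^ (q - 1) := by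
  refine ⟨(c ^ q)⁻¹, by positivity, fun t v ht hv hle => ?_⟩
  have h1 : (c * t) ^ q ≤ v ^ (q - 1) := by
    calc (c * t) ^ q ≤ (v ^ (1 - 1 / q)) ^ q :=
          Real.rpow_le_rpow (by positivity) hle (by linarith)
      _ = v ^ (q - 1) := by
          rw [← Real.rpow_mul hv.le]; congr 1; field_simp
  rw [Real.mul_rpow hc.le ht.le] at h1
  rw [Real.div_rpow hv.le ht.le, le_inv_mul_iff₀ (by positivity), le_div_iff₀ (by positivity)]
  calc c ^ q * t * t ^ (q - 1) = c ^ q * t ^ q := by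
        rw [Real.rpow_sub_one ht.ne']; field_simp
    _ ≤ _ := h1

/-- Superlinear growth at infinity. -/
theorem exists_le_mul_div_rpow_atTop {M Q : ℝ} (hM : 0 < M) (hQ : 1 < Q)
    (hf : ∀ t, 0 < t → HasDerivAt f (g t) t) (hg : ∀ t, 0 < t → HasDerivAt g (h t) t)
    (hfpos : ∀ t, 0 < t → 0 < f t) (hgM : 0 < g M)
    (hq : ∀ t, M ≤ t → g t ^ 2 ≤ Q * (f t * h t)) :
    ∃ C, 0 ≤ C ∧ ∀ t, M ≤ t → t ≤ C * (f t / t) ^ (Q - 1) := by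
  obtain ⟨c, hc, hcg⟩ := exists_rpow_le_deriv_atTop hM (by linarith) hf hg hfpos hgM hq
  have hQ1 : 0 < 1 - 1 / Q := by
    rw [sub_pos, div_lt_one (by linarith)]; exact hQ
  set A := f M ^ (1 - 1 / Q) with hA
  have hA0 : 0 < A := Real.rpow_pos_of_pos (hfpos M hM) _
  set d := min ((1 - 1 / Q) * c) (A / M) with hd
  have hd0 : 0 < d := lt_min (by positivity) (by positivity)
  obtain ⟨C, hC0, hC⟩ := exists_le_mul_div_rpow hQ hd0
  refine ⟨C, hC0, fun t ht => hC t (f t) (hM.trans_le ht) (hfpos t (hM.trans_le ht)) ?_⟩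
  have h1 := mul_sub_le_rpow_sub_rpow hQ hM ht hf hfpos fun r hr _ => hcg r hr
  have h2 : d * (t - M) ≤ (1 - 1 / Q) * c * (t - M) :=
    mul_le_mul_of_nonneg_right (min_le_left _ _) (by linarith)
  have h3 : d * M ≤ A := (le_div_iff₀ hM).1 (min_le_right _ _)
  rw [← hA] at h1
  linarith

/-- Growth near zero. -/
theorem exists_le_mul_div_rpow_zero {s q : ℝ} (hs : 0 < s) (hq1 : 1 < q)
    (hf : ∀ t, 0 < t → HasDerivAt f (g t) t) (hg : ∀ t, 0 < t → HasDerivAt g (h t) t)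
    (hfpos : ∀ t, 0 < t → 0 < f t) (hgs : 0 < g s)
    (hq : ∀ t, 0 < t → t ≤ s → q * (f t * h t) ≤ g t ^ 2) :
    ∃ C, 0 ≤ C ∧ ∀ t, 0 < t → t ≤ s → t ≤ C * (f t / t) ^ (q - 1) := by
  obtain ⟨c, hc, hcg⟩ := exists_rpow_le_deriv_zero hs (by linarith) hf hg hfpos hgs hq
  have hQ1 : 0 < 1 - 1 / q := by
    rw [sub_pos, div_lt_one (by linarith)]; exact hq1
  obtain ⟨C, hC0, hC⟩ := exists_le_mul_div_rpow hq1 (show 0 < (1 - 1 / q) * c by positivity)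
  refine ⟨C, hC0, fun t ht0 ht => hC t (f t) ht0 (hfpos t ht0) ?_⟩
  have hlim : Tendsto (fun r => (1 - 1 / q) * c * (t - r)) (𝓝[>] 0)
      (𝓝 ((1 - 1 / q) * c * (t - 0))) :=
    (Continuous.tendsto (by fun_prop) 0).mono_left nhdsWithin_le_nhds
  rw [sub_zero] at hlim
  refine le_of_tendsto hlim ?_
  filter_upwards [Ioc_mem_nhdsGT ht0] with r hr
  have h1 := mul_sub_le_rpow_sub_rpow hq1 hr.1 hr.2 hf hfpos
    fun y hy hyt => hcg y (hr.1.trans_le hy) (hyt.trans ht)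
  have := Real.rpow_nonneg (hfpos r hr.1).le (1 - 1 / q)
  linarith

theorem hasDerivAt_max_zero_sq (x : ℝ) :
    HasDerivAt (fun y : ℝ => max 0 y ^ 2) (2 * max 0 x) x := by
  have hne : ∀ x : ℝ, x ≠ 0 → HasDerivAt (fun y : ℝ => max 0 y ^ 2) (2 * max 0 x) x := by
    intro x hx
    rcases hx.lt_or_gt with hx | hx
    · rw [max_eq_left hx.le, mul_zero]
      refine (hasDerivAt_const x (0 : ℝ)).congr_of_eventuallyEq ?_
      filter_upwards [gt_mem_nhds hx] with y hy
      simp [max_eq_left hy.le]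
    · rw [max_eq_right hx.le]
      have := hasDerivAt_pow 2 x
      simp only [Nat.cast_ofNat, Nat.add_one_sub_one, pow_one] at this
      refine this.congr_of_eventuallyEq ?_
      filter_upwards [lt_mem_nhds hx] with y hy
      simp [max_eq_right hy.le]
  by_cases hx : x = 0
  · subst hx
    exact hasDerivAt_of_hasDerivAt_of_ne (g := fun x => 2 * max 0 x) hne
      (by fun_prop) (by fun_prop)
  · exact hne x hx

/-- A profile equal to `v` for `v ≥ ε` and comparable to `v ^ (1 + β)` near zero. -/
theorem exists_profile {ε β : ℝ} (hε : 0 < ε) (hβ : 0 < β) :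
    ∃ Φ Φ' : ℝ → ℝ, (∀ v, 0 < v → HasDerivAt Φ (Φ' v) v) ∧ ContinuousOn Φ' (Set.Ioi 0) ∧
      Tendsto Φ' (𝓝[>] 0) (𝓝 0) ∧ (∀ v, 0 < v → 0 < Φ v) ∧ (∀ v, 0 < v → Φ v ≤ v) ∧
      (∀ v, 0 < v → Φ v ≤ v * Φ' v) ∧ (∀ v, 0 < v → v * Φ' v ≤ (1 + β) * Φ v) ∧
      (∀ v, ε ≤ v → Φ v = v ∧ Φ' v = 1) ∧
      ∃ C, 0 ≤ C ∧ ∀ v, 0 < v → Φ v ≤ C * v ^ (1 + β) := by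
  set y : ℝ → ℝ := fun v => (v / ε) ^ β with hy
  set m : ℝ → ℝ := fun v => max 0 (1 - y v) with hm
  have hy0 : ∀ v, 0 < v → 0 < y v := fun v hv => Real.rpow_pos_of_pos (by positivity) _
  have hm0 : ∀ v, 0 ≤ m v := fun v => le_max_left _ _
  have hm1 : ∀ v, 0 < v → m v < 1 := fun v hv => max_lt one_pos (by linarith [hy0 v hv])
  have hmy : ∀ v, 1 - y v ≤ m v := fun v => le_max_right _ _
  have hmy' : ∀ v, m v = 0 ∨ m v = 1 - y v := fun v => max_choice _ _
  have hyd : ∀ v, 0 < v → HasDerivAt y (β * y v / v) v := fun v hv => by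
    refine (((hasDerivAt_id v).div_const ε).rpow_const (p := β)
      (Or.inl (div_pos hv hε).ne')).congr_deriv ?_
    simp only [hy, id]
    rw [Real.rpow_sub_one (by positivity)]
    field_simp
  have hyc : ContinuousOn y (Set.Ioi 0) := fun v hv => (hyd v hv).continuousAt.continuousWithinAt
  have hT : ∀ v, 0 < v → 2 * y v * m v ≤ 1 - m v ^ 2 := fun v hv => by
    rcases hmy' v with h | h
    · rw [h]; norm_num
    · rw [h]; nlinarith [sq_nonneg (y v)]
  have hP : ∀ v, 0 < v → 1 - m v ^ 2 ≤ 2 * y v := fun v hv => by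
    nlinarith [hm0 v, hm1 v hv, hmy v, sq_nonneg (1 - m v)]
  have hPpos : ∀ v, 0 < v → 0 < 1 - m v ^ 2 := fun v hv => by nlinarith [hm0 v, hm1 v hv]
  have hTn : ∀ v, 0 < v → 0 ≤ y v * m v := fun v hv => mul_nonneg (hy0 v hv).le (hm0 v)
  refine ⟨fun v => v * (1 - m v ^ 2), fun v => 1 - m v ^ 2 + β * (2 * y v * m v),
    fun v hv => ?_, ?_, ?_, fun v hv => mul_pos hv (hPpos v hv), fun v hv => ?_, fun v hv => ?_,
    fun v hv => ?_, fun v hv => ?_, 2 / ε ^ β, by positivity, fun v hv => ?_⟩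
  · have h1 := (hasDerivAt_max_zero_sq (1 - y v)).comp v ((hyd v hv).const_sub 1)
    refine ((hasDerivAt_id v).mul (h1.const_sub 1)).congr_deriv ?_
    simp only [hm, id, Function.comp]
    field_simp
  · have : ContinuousOn m (Set.Ioi 0) := by fun_prop
    fun_prop
  · have hlim : Tendsto (fun v => (1 + β) * (2 * y v)) (𝓝[>] 0) (𝓝 0) := by
      have : Continuous fun v => (1 + β) * (2 * y v) := by
        have := Real.continuous_rpow_const hβ.le
        simp only [hy]
        fun_prop
      have := this.tendsto 0
      simp only [hy, zero_div, Real.zero_rpow hβ.ne', mul_zero] at this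
      exact this.mono_left nhdsWithin_le_nhds
    refine squeeze_zero' ?_ ?_ hlim
    · filter_upwards [self_mem_nhdsWithin] with v hv
      have := hTn v hv
      have := hPpos v hv
      nlinarith
    · filter_upwards [self_mem_nhdsWithin] with v hv
      nlinarith [hT v hv, hP v hv]
  · nlinarith [sq_nonneg (m v)]
  · have := mul_nonneg hv.le (mul_nonneg hβ.le (hTn v hv))
    nlinarith
  · have := mul_le_mul_of_nonneg_left (hT v hv) (mul_nonneg hv.le hβ.le)
    nlinarith
  · have : 1 ≤ y v := Real.one_le_rpow ((one_le_div hε).2 hv) hβ.le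
    have : m v = 0 := max_eq_left (by linarith)
    simp [this]
  · calc v * (1 - m v ^ 2) ≤ v * (2 * y v) := by gcongr; exact hP v hv
      _ = _ := by
        simp only [hy]
        rw [Real.div_rpow hv.le hε.le, Real.rpow_add hv, Real.rpow_one]
        ring

theorem continuous_of_continuousOn_Ioi {F : ℝ → ℝ} (h0 : ∀ t ≤ 0, F t = 0)
    (hF : ContinuousOn F (Set.Ioi 0)) (hlim : Tendsto F (𝓝[>] 0) (𝓝 0)) : Continuous F := by
  rw [continuous_iff_continuousAt]
  intro t
  rcases lt_trichotomy t 0 with ht | rfl | ht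
  · refine (continuousAt_const (y := (0 : ℝ))).congr ?_
    filter_upwards [gt_mem_nhds ht] with s hs using (h0 s hs.le).symm
  · rw [continuousAt_iff_continuous_left'_right']
    refine ⟨?_, ?_⟩
    · refine (continuousWithinAt_const (b := (0 : ℝ))).congr (fun s hs => h0 s ?_) (h0 0 le_rfl)
      exact le_of_lt hs
    · rw [ContinuousWithinAt, h0 0 le_rfl]
      exact hlim
  · exact hF.continuousAt (Ioi_mem_nhds ht)

/-- `κ G - ψ` stays nonnegative when `ψ ≥ 0` vanishes at `0` and `ψ' ≤ κ G'`. -/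
theorem le_mul_of_deriv_le_mul {ψ ψ' G G' : ℝ → ℝ} {κ s : ℝ} (hκ : 0 ≤ κ)
    (hψ : ∀ t, HasDerivAt ψ (ψ' t) t) (hψ0 : ψ 0 = 0)
    (hG : ∀ t, 0 < t → HasDerivAt G (G' t) t) (hG0 : ∀ t, 0 < t → 0 ≤ G t)
    (hle : ∀ t, 0 < t → t ≤ s → ψ' t ≤ κ * G' t) :
    ∀ t, 0 < t → t ≤ s → ψ t ≤ κ * G t := by
  intro t ht hts
  have hmono : MonotoneOn (fun r => κ * G r - ψ r) (Set.Ioc 0 s) :=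
    monotoneOn_of_hasDerivAt_nonneg (convex_Ioc 0 s)
      (fun r hr => ((hG r hr.1).const_mul κ).sub (hψ r)) fun r hr => sub_nonneg.2 (hle r hr.1 hr.2)
  have hlim : Tendsto ψ (𝓝[>] 0) (𝓝 0) := by
    have := (hψ 0).continuousAt.tendsto
    rw [hψ0] at this
    exact this.mono_left nhdsWithin_le_nhds
  have : -(κ * G t - ψ t) ≤ 0 := by
    refine ge_of_tendsto hlim ?_
    filter_upwards [Ioc_mem_nhdsGT ht] with r hr
    have h1 := hmono ⟨hr.1, hr.2.trans hts⟩ ⟨ht, hts⟩ hr.2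
    have h2 := mul_nonneg hκ (hG0 r hr.1)
    simp only at h1
    linarith
  linarith

set_option maxHeartbeats 2000000 in
theorem exists_test_function {β δ q s M Q : ℝ}
    (hf : ∀ t, 0 < t → HasDerivAt f (g t) t) (hg : ∀ t, 0 < t → HasDerivAt g (h t) t)
    (hf0 : f 0 = 0) (hflim : Tendsto f (𝓝[>] 0) (𝓝 0))
    (hfpos : ∀ t, 0 < t → 0 < f t) (hgpos : ∀ t, 0 < t → 0 < g t) (hh : ∀ t, 0 < t → 0 ≤ h t)
    (hβ : 0 < β) (hδ : 0 < δ) (hs : 0 < s) (hsM : s ≤ M) (hq0 : 0 < q) (hQ : 0 < Q)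
    (hβs : ∀ t, 0 < t → t ≤ s → (β ^ 2 + δ) * g t ^ 2 ≤ f t * h t)
    (hqs : ∀ t, 0 < t → t ≤ s → q * (f t * h t) ≤ g t ^ 2)
    (hQM : ∀ t, M ≤ t → g t ^ 2 ≤ Q * (f t * h t)) :
    ∃ φ φ' ψ H : ℝ → ℝ, ∃ c K : ℝ, 0 < c ∧ 0 ≤ K ∧ (∀ t, HasDerivAt φ (φ' t) t) ∧
      Continuous φ' ∧ (∀ t, HasDerivAt ψ (φ' t ^ 2) t) ∧
      (∀ t, HasDerivAt H (φ t * φ' t - ψ t) t) ∧ φ 0 = 0 ∧ (∀ t, 0 < t → 0 < φ t) ∧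
      (Continuous fun t => g t * φ t ^ 2) ∧
      (∀ t, 0 ≤ t → f t * ψ t ≤ (1 - c) * (g t * φ t ^ 2)) ∧
      (∀ t, 0 ≤ t → |H t| ≤ φ t ^ 2) ∧
      ∀ t, 0 < t → φ t ^ 2 ≤ K * (g t ^ (2 * (1 + β) * q) + g t ^ (2 * Q)) := by
  have hfmono : MonotoneOn f (Set.Ioi 0) := monotoneOn_of_hasDerivAt_nonneg (convex_Ioi 0)
    (fun t ht => hf t ht) fun t ht => (hgpos t ht).le
  have hgmono : MonotoneOn g (Set.Ioi 0) := monotoneOn_of_hasDerivAt_nonneg (convex_Ioi 0)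
    (fun t ht => hg t ht) fun t ht => hh t ht
  have hM : 0 < M := hs.trans_le hsM
  have hfc : ContinuousOn f (Set.Ioi 0) := fun t ht => (hf t ht).continuousAt.continuousWithinAt
  have hgc : ContinuousOn g (Set.Ioi 0) := fun t ht => (hg t ht).continuousAt.continuousWithinAt
  have hfmap : Set.MapsTo f (Set.Ioi 0) (Set.Ioi 0) := fun t ht => hfpos t ht
  have hflim' : Tendsto f (𝓝[>] 0) (𝓝[>] 0) :=
    tendsto_nhdsWithin_iff.2 ⟨hflim, by filter_upwards [self_mem_nhdsWithin] with t ht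
                                        using hfpos t ht⟩
  obtain ⟨Φ, Φ', hΦd, hΦ'c, hΦ'0, hΦpos, hΦle, hΦ1, hΦ2, hΦε, C, hC, hΦC⟩ :=
    exists_profile (hfpos s hs) hβ
  have hΦ'pos : ∀ v, 0 < v → 0 < Φ' v := fun v hv =>
    pos_of_mul_pos_right ((hΦpos v hv).trans_le (hΦ1 v hv)) hv.le
  have hεs : ∀ t, s ≤ t → f s ≤ f t := fun t ht => hfmono hs (hs.trans_le ht) ht
  set φ : ℝ → ℝ := fun t => if t ≤ 0 then 0 else Φ (f t) with hφdef
  set φ' : ℝ → ℝ := fun t => if t ≤ 0 then 0 else g t * Φ' (f t) with hφ'def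
  have hφ_pos : ∀ t, 0 < t → φ t = Φ (f t) := fun t ht => if_neg ht.not_ge
  have hφ'_pos : ∀ t, 0 < t → φ' t = g t * Φ' (f t) := fun t ht => if_neg ht.not_ge
  have hφ_neg : ∀ t, t ≤ 0 → φ t = 0 := fun t ht => if_pos ht
  have hφ'_neg : ∀ t, t ≤ 0 → φ' t = 0 := fun t ht => if_pos ht
  have hΦc : ContinuousOn Φ (Set.Ioi 0) := fun v hv => (hΦd v hv).continuousAt.continuousWithinAt
  have hg1 : ∀ᶠ t in 𝓝[>] (0 : ℝ), 0 < t ∧ g t ≤ g s := by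
    filter_upwards [Ioc_mem_nhdsGT hs] with t ht using ⟨ht.1, hgmono ht.1 hs ht.2⟩
  have hφc : Continuous φ := by
    refine continuous_of_continuousOn_Ioi hφ_neg ?_ ?_
    · exact (hΦc.comp hfc hfmap).congr fun t ht => hφ_pos t ht
    · refine squeeze_zero' ?_ ?_ hflim
      · filter_upwards [self_mem_nhdsWithin] with t ht
        rw [hφ_pos t ht]; exact (hΦpos _ (hfpos t ht)).le
      · filter_upwards [self_mem_nhdsWithin] with t ht
        rw [hφ_pos t ht]; exact hΦle _ (hfpos t ht)
  have hφ'c : Continuous φ' := by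
    refine continuous_of_continuousOn_Ioi hφ'_neg ?_ ?_
    · exact (hgc.mul (hΦ'c.comp hfc hfmap)).congr fun t ht => hφ'_pos t ht
    · have hlim : Tendsto (fun t => g s * Φ' (f t)) (𝓝[>] 0) (𝓝 0) := by
        simpa using (hΦ'0.comp hflim').const_mul (g s)
      refine squeeze_zero' ?_ ?_ hlim
      · filter_upwards [self_mem_nhdsWithin] with t ht
        rw [hφ'_pos t ht]; exact mul_nonneg (hgpos t ht).le (hΦ'pos _ (hfpos t ht)).le
      · filter_upwards [hg1] with t ht
        rw [hφ'_pos t ht.1]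
        exact mul_le_mul_of_nonneg_right ht.2 (hΦ'pos _ (hfpos t ht.1)).le
  have hφd : ∀ t, HasDerivAt φ (φ' t) t := by
    have hne : ∀ t, t ≠ 0 → HasDerivAt φ (φ' t) t := by
      intro t ht
      rcases ht.lt_or_gt with ht | ht
      · rw [hφ'_neg t ht.le]
        refine (hasDerivAt_const t (0 : ℝ)).congr_of_eventuallyEq ?_
        filter_upwards [gt_mem_nhds ht] with y hy using hφ_neg y hy.le
      · rw [hφ'_pos t ht, mul_comm]
        refine ((hΦd _ (hfpos t ht)).comp t (hf t ht)).congr_of_eventuallyEq ?_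
        filter_upwards [lt_mem_nhds ht] with y hy using hφ_pos y hy
    intro t
    by_cases ht : t = 0
    · subst ht
      exact hasDerivAt_of_hasDerivAt_of_ne hne hφc.continuousAt hφ'c.continuousAt
    · exact hne t ht
  set ψ : ℝ → ℝ := fun t => ∫ r in (0 : ℝ)..t, φ' r ^ 2 with hψdef
  have hψd : ∀ t, HasDerivAt ψ (φ' t ^ 2) t := fun t =>
    ((hφ'c.pow 2).integral_hasStrictDerivAt 0 t).hasDerivAt
  have hψ0 : ψ 0 = 0 := intervalIntegral.integral_same
  have hψc : Continuous ψ := continuous_iff_continuousAt.2 fun t => (hψd t).continuousAt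
  have hHc : Continuous fun t => φ t * φ' t - ψ t := by fun_prop
  set H : ℝ → ℝ := fun t => ∫ r in (0 : ℝ)..t, (φ r * φ' r - ψ r) with hHdef
  have hHd : ∀ t, HasDerivAt H (φ t * φ' t - ψ t) t := fun t =>
    (hHc.integral_hasStrictDerivAt 0 t).hasDerivAt
  have hH0 : H 0 = 0 := intervalIntegral.integral_same
  set G : ℝ → ℝ := fun t => g t * Φ (f t) ^ 2 / f t with hGdef
  set G' : ℝ → ℝ := fun t => (f t * h t * Φ (f t) ^ 2 +
    g t ^ 2 * (2 * Φ (f t) * (f t * Φ' (f t)) - Φ (f t) ^ 2)) / f t ^ 2 with hG'def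
  have hGd : ∀ t, 0 < t → HasDerivAt G (G' t) t := fun t ht => by
    have hft := (hfpos t ht).ne'
    refine (((hg t ht).mul (((hΦd _ (hfpos t ht)).comp t (hf t ht)).pow 2)).div
      (hf t ht) hft).congr_deriv ?_
    simp only [hG'def, Function.comp, Pi.pow_apply, Pi.mul_apply]
    field_simp
    ring
  have hGpos : ∀ t, 0 < t → 0 < G t := fun t ht =>
    div_pos (mul_pos (hgpos t ht) (pow_pos (hΦpos _ (hfpos t ht)) 2)) (hfpos t ht)
  set κ := (1 + β) ^ 2 / ((1 + β) ^ 2 + δ) with hκ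
  have hκ0 : 0 ≤ κ := by positivity
  have hκ1 : κ < 1 := by rw [hκ, div_lt_one (by positivity)]; linarith
  have hψs : ∀ t, 0 < t → t ≤ s → φ' t ^ 2 ≤ κ * G' t := by
    intro t ht hts
    have hft := hfpos t ht
    have h1 := hΦ1 _ hft
    have h2 := hΦ2 _ hft
    have hΦp := hΦpos _ hft
    rw [hφ'_pos t ht, hκ, hG'def, div_mul_div_comm, le_div_iff₀ (by positivity)]
    set P := Φ (f t)
    set D := f t * Φ' (f t) with hD
    have e : (g t * Φ' (f t)) ^ 2 * (((1 + β) ^ 2 + δ) * f t ^ 2) =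
        ((1 + β) ^ 2 + δ) * (g t ^ 2 * D ^ 2) := by rw [hD]; ring
    rw [e]
    have hD2 : D ^ 2 ≤ (1 + β) ^ 2 * P ^ 2 := by
      rw [← mul_pow]; exact pow_le_pow_left₀ (by linarith) h2 2
    have hDP : (D - P) ^ 2 ≤ β ^ 2 * P ^ 2 := by
      rw [← mul_pow]; exact pow_le_pow_left₀ (by linarith) (by linarith) 2
    have h3 := mul_le_mul_of_nonneg_right (hβs t ht hts) (sq_nonneg P)
    have h4 := mul_le_mul_of_nonneg_left hDP (sq_nonneg (g t))
    have h5 := mul_le_mul_of_nonneg_left hD2 (mul_nonneg hδ.le (sq_nonneg (g t)))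
    have h6 : 0 ≤ (1 + β) ^ 2 := by positivity
    have h7 : δ * (g t ^ 2 * P ^ 2) + g t ^ 2 * D ^ 2 ≤
      f t * h t * P ^ 2 + g t ^ 2 * (2 * P * D - P ^ 2) := by nlinarith
    have h8 := mul_le_mul_of_nonneg_left h7 h6
    nlinarith
  have hψG1 : ∀ t, 0 < t → t ≤ s → ψ t ≤ κ * G t :=
    le_mul_of_deriv_le_mul hκ0 hψd hψ0 hGd (fun t ht => (hGpos t ht).le) hψs
  have hbig : ∀ t, s ≤ t → φ' t ^ 2 = g t ^ 2 ∧ G' t = f t * h t + g t ^ 2 := by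
    intro t ht
    have ht0 := hs.trans_le ht
    obtain ⟨e1, e2⟩ := hΦε _ (hεs t ht)
    rw [hφ'_pos t ht0, hG'def]
    simp only [e1, e2]
    have := (hfpos t ht0).ne'
    refine ⟨by ring, by field_simp; ring⟩
  have hGψ : ∀ r t, s ≤ r → r ≤ t → G r - ψ r ≤ G t - ψ t := by
    intro r t hr hrt
    refine monotoneOn_of_hasDerivAt_nonneg (F := fun t => G t - ψ t) (convex_Ici s)
      (fun y hy => (hGd y (hs.trans_le hy)).sub (hψd y)) (fun y hy => ?_) hr (hr.trans hrt) hrt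
    obtain ⟨e1, e2⟩ := hbig y hy
    have := mul_nonneg (hfpos y (hs.trans_le hy)).le (hh y (hs.trans_le hy))
    rw [e1, e2]; linarith
  have hGmono : ∀ r t, s ≤ r → r ≤ t → G r ≤ G t := by
    intro r t hr hrt
    refine monotoneOn_of_hasDerivAt_nonneg (convex_Ici s)
      (fun y hy => hGd y (hs.trans_le hy)) (fun y hy => ?_) hr (hr.trans hrt) hrt
    rw [(hbig y hy).2]
    have := mul_nonneg (hfpos y (hs.trans_le hy)).le (hh y (hs.trans_le hy))
    positivity
  have hGM := hGpos M hM
  have hGs := hGpos s hs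
  set d := (1 - κ) * G s / G M with hd
  have hd0 : 0 < d := div_pos (mul_pos (by linarith) hGs) hGM
  have hψG2 : ∀ t, s ≤ t → t ≤ M → ψ t ≤ (1 - d) * G t := by
    intro t hst htM
    have h1 := hGψ s t le_rfl hst
    have h2 := hψG1 s hs le_rfl
    have h3 := hGmono t M hst htM
    have h4 : d * G t ≤ (1 - κ) * G s := by
      calc d * G t ≤ d * G M := mul_le_mul_of_nonneg_left h3 hd0.le
        _ = _ := div_mul_cancel₀ _ hGM.ne'
    linarith
  set c := min (min (1 - κ) d) (1 / (1 + Q)) with hc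
  have hc0 : 0 < c := lt_min (lt_min (by linarith) hd0) (by positivity)
  have hcκ : c ≤ 1 - κ := (min_le_left _ _).trans (min_le_left _ _)
  have hcd : c ≤ d := (min_le_left _ _).trans (min_le_right _ _)
  have hcQ : c ≤ 1 / (1 + Q) := min_le_right _ _
  have hψGc : ∀ t, 0 < t → ψ t ≤ (1 - c) * G t := by
    intro t ht
    have hGt := hGpos t ht
    rcases le_total t s with hts | hts
    · have := hψG1 t ht hts
      nlinarith
    rcases le_total t M with htM | htM
    · have := hψG2 t hts htM
      nlinarith
    have hmono : MonotoneOn (fun t => (1 - c) * G t - ψ t) (Set.Ici M) := by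
      refine monotoneOn_of_hasDerivAt_nonneg (convex_Ici M)
        (fun y hy => ((hGd y (hM.trans_le hy)).const_mul _).sub (hψd y)) fun y hy => ?_
      obtain ⟨e1, e2⟩ := hbig y (hsM.trans hy)
      rw [e1, e2]
      have h1 := hQM y hy
      have h2 := mul_nonneg (hfpos y (hM.trans_le hy)).le (hh y (hM.trans_le hy))
      have h3 : c * (1 + Q) ≤ 1 := by rwa [le_div_iff₀ (by positivity)] at hcQ
      nlinarith [mul_le_mul_of_nonneg_right h3 h2, mul_le_mul_of_nonneg_left h1 hc0.le]
    have h1 := hmono (Set.mem_Ici.2 le_rfl) (Set.mem_Ici.2 htM) htM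
    have h2 := hψG2 M hsM le_rfl
    simp only at h1
    nlinarith
  have hψnn : ∀ t, 0 ≤ t → 0 ≤ ψ t := fun t ht =>
    intervalIntegral.integral_nonneg ht fun r _ => sq_nonneg _
  have hc1 : 0 ≤ 1 - c := by linarith
  have hψG : ∀ t, 0 < t → ψ t ≤ φ t * φ' t := by
    intro t ht
    have hft := hfpos t ht
    have hGt := hGpos t ht
    calc ψ t ≤ (1 - c) * G t := hψGc t ht
      _ ≤ G t := by nlinarith
      _ ≤ φ t * φ' t := by
        rw [hφ_pos t ht, hφ'_pos t ht, hGdef, div_le_iff₀ hft]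
        have := mul_le_mul_of_nonneg_left (hΦ1 _ hft)
          (mul_pos (hgpos t ht) (hΦpos _ hft)).le
        nlinarith
  have hH'nn : ∀ t, 0 ≤ t → 0 ≤ φ t * φ' t - ψ t := by
    intro t ht
    rcases ht.eq_or_lt with rfl | ht
    · rw [hφ_neg 0 le_rfl, hψ0]; simp
    · linarith [hψG t ht]
  have hφ0 : φ 0 = 0 := hφ_neg 0 le_rfl
  obtain ⟨c₁, hc₁, hgc₁⟩ := exists_rpow_le_deriv_zero hs hq0 hf hg hfpos (hgpos s hs) hqs
  obtain ⟨c₂, hc₂, hgc₂⟩ := exists_rpow_le_deriv_atTop hM hQ hf hg hfpos (hgpos M hM) hQM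
  have hpow : ∀ {e a b r w : ℝ}, 0 < e → 0 < a → 0 < r → 0 ≤ w → 0 < b → a * b ^ (1 / r) ≤ e →
      b ^ w ≤ a⁻¹ ^ (w * r) * e ^ (w * r) := by
    intro e a b r w he ha hr hw hb hle
    rw [← Real.mul_rpow (by positivity) he.le]
    calc b ^ w = (b ^ (1 / r)) ^ (w * r) := by
          rw [← Real.rpow_mul hb.le]; congr 1; field_simp
      _ ≤ _ := Real.rpow_le_rpow (by positivity) ((le_inv_mul_iff₀ ha).2 hle) (by positivity)
  have hgsM : 0 < g s ^ (2 * Q) := Real.rpow_pos_of_pos (hgpos s hs) _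
  have hK1 : 0 ≤ C ^ 2 * c₁⁻¹ ^ (2 * (1 + β) * q) := by positivity
  have hK2 : 0 ≤ c₂⁻¹ ^ (2 * Q) := by positivity
  have hK3 : 0 ≤ f M ^ 2 / g s ^ (2 * Q) := by positivity
  refine ⟨φ, φ', ψ, H, c, C ^ 2 * c₁⁻¹ ^ (2 * (1 + β) * q) + c₂⁻¹ ^ (2 * Q) + f M ^ 2 / g s ^ (2 * Q), hc0,
    by positivity, hφd, hφ'c, hψd, hHd, hφ0,
    fun t ht => by rw [hφ_pos t ht]; exact hΦpos _ (hfpos t ht), ?_, ?_, ?_, ?_⟩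
  · refine continuous_of_continuousOn_Ioi (fun t ht => by rw [hφ_neg t ht]; simp)
      (hgc.mul (hφc.continuousOn.pow 2)) ?_
    have hlim : Tendsto (fun t => g s * φ t ^ 2) (𝓝[>] 0) (𝓝 0) := by
      have := ((hφc.tendsto 0).pow 2).const_mul (g s)
      rw [hφ0] at this
      simpa using this.mono_left nhdsWithin_le_nhds
    refine squeeze_zero' ?_ ?_ hlim
    · filter_upwards [self_mem_nhdsWithin] with t ht
      exact mul_nonneg (hgpos t ht).le (sq_nonneg _)
    · filter_upwards [hg1] with t ht
      exact mul_le_mul_of_nonneg_right ht.2 (sq_nonneg _)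
  · intro t ht
    rcases ht.eq_or_lt with rfl | ht
    · rw [hf0, hφ0]; simp
    · have h1 := mul_le_mul_of_nonneg_left (hψGc t ht) (hfpos t ht).le
      refine h1.trans_eq ?_
      have := (hfpos t ht).ne'
      rw [hφ_pos t ht, hGdef]
      field_simp
  · have hHnn : MonotoneOn H (Set.Ici 0) :=
      monotoneOn_of_hasDerivAt_nonneg (convex_Ici 0) (fun t _ => hHd t) fun t ht => hH'nn t ht
    have hHle : MonotoneOn (fun t => φ t ^ 2 / 2 - H t) (Set.Ici 0) :=
      monotoneOn_of_hasDerivAt_nonneg (convex_Ici 0)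
        (fun t _ => (((hφd t).pow 2).div_const 2).sub (hHd t)) fun t ht => by
          have := hψnn t ht
          norm_num
          linarith
    intro t ht
    have h1 := hHnn (Set.mem_Ici.2 le_rfl) (Set.mem_Ici.2 ht) ht
    have h2 := hHle (Set.mem_Ici.2 le_rfl) (Set.mem_Ici.2 ht) ht
    simp only [hφ0, hH0] at h1 h2
    rw [abs_of_nonneg h1]
    nlinarith [sq_nonneg (φ t)]
  · intro t ht
    have hgt := hgpos t ht
    have hft := hfpos t ht
    have p1 : 0 ≤ g t ^ (2 * (1 + β) * q) := by positivity
    have p2 : 0 ≤ g t ^ (2 * Q) := by positivity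
    have hφf : φ t ^ 2 ≤ f t ^ 2 := by
      rw [hφ_pos t ht]
      exact pow_le_pow_left₀ (hΦpos _ hft).le (hΦle _ hft) 2
    rcases le_total t s with hts | hts
    · have h1 : φ t ^ 2 ≤ C ^ 2 * f t ^ (2 * (1 + β)) := by
        rw [hφ_pos t ht]
        refine (pow_le_pow_left₀ (hΦpos _ hft).le (hΦC _ hft) 2).trans_eq ?_
        rw [mul_pow, ← Real.rpow_natCast (f t ^ (1 + β)), ← Real.rpow_mul hft.le]
        congr 2; push_cast; ring
      have h2 := hpow hgt hc₁ hq0 (w := 2 * (1 + β)) (by positivity) hft (hgc₁ t ht hts)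
      have h3 := mul_le_mul_of_nonneg_left h2 (sq_nonneg C)
      nlinarith [mul_nonneg hK1 p2, mul_nonneg hK2 p1, mul_nonneg hK2 p2, mul_nonneg hK3 p1,
        mul_nonneg hK3 p2]
    rcases le_total t M with htM | htM
    · have h1 : f t ^ 2 ≤ f M ^ 2 := pow_le_pow_left₀ hft.le (hfmono ht hM htM) 2
      have h2 : g s ^ (2 * Q) ≤ g t ^ (2 * Q) :=
        Real.rpow_le_rpow (hgpos s hs).le (hgmono hs ht hts) (by positivity)
      have h3 : f M ^ 2 ≤ f M ^ 2 / g s ^ (2 * Q) * g t ^ (2 * Q) := by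
        rw [div_mul_eq_mul_div, le_div_iff₀ hgsM]
        exact mul_le_mul_of_nonneg_left h2 (sq_nonneg _)
      nlinarith [mul_nonneg hK1 p1, mul_nonneg hK1 p2, mul_nonneg hK2 p1, mul_nonneg hK2 p2,
        mul_nonneg hK3 p1]
    · have h2 := hpow hgt hc₂ hQ (w := 2) (by positivity) hft (hgc₂ t htM)
      rw [Real.rpow_two] at h2
      nlinarith [mul_nonneg hK1 p1, mul_nonneg hK1 p2, mul_nonneg hK2 p1, mul_nonneg hK3 p2,
        mul_nonneg hK3 p1]

end RealVariable

/-- Liouville theorem when `f` is superlinear in the sense that `t ≲ (f(t)/t)^γ`. -/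
theorem eq_zero_of_le_mul_div_rpow {N : ℕ} {f : ℝ → ℝ}
    (hcont : ContinuousOn f (Set.Ici 0)) (hmono : MonotoneOn f (Set.Ici 0))
    (hpos : ∀ t : ℝ, 0 < t → 0 < f t) (hf0 : 0 ≤ f 0)
    {u : EuclideanSpace ℝ (Fin N) → ℝ} (hu : ContDiff ℝ 2 u) (hnonneg : ∀ x, 0 ≤ u x)
    (hsol : ∀ x, -lap u x = f (u x)) {s C₁ M C₂ γ γ' : ℝ} (hs : 0 < s) (hM : 0 < M)
    (hC₁ : 0 ≤ C₁) (hC₂ : 0 ≤ C₂) (hγ0 : 0 ≤ γ) (hγγ' : γ ≤ γ') (hγ : (N : ℝ) < 2 * γ + 2)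
    (h₁ : ∀ t, 0 < t → t ≤ s → t ≤ C₁ * (f t / t) ^ γ)
    (h₂ : ∀ t, M ≤ t → t ≤ C₂ * (f t / t) ^ γ') : ∀ x, u x = 0 := by
  have hfnn : ∀ t, 0 ≤ t → 0 ≤ f t := fun t ht => by
    rcases ht.eq_or_lt with rfl | ht
    · exact hf0
    · exact (hpos t ht).le
  have he : 0 < f s / M := div_pos (hpos s hs) hM
  set C₃ := M / (f s / M) ^ γ with hC₃
  have hC₃0 : 0 ≤ C₃ := by positivity
  have hk : ∀ x, f (u x) = 0 := by
    refine eq_zero_of_cutoff_estimate (a := u) (b := fun x => f (u x) / u x) hu.continuous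
      (hcont.comp_continuous hu.continuous hnonneg) hnonneg (fun x => hfnn _ (hnonneg x))
      hγ hγ0 hγγ' (K := C₁ + C₂ + C₃) (by positivity) (fun x => ?_) zero_le_one fun ζ hζ hζc => ?_
    · rcases (hnonneg x).eq_or_lt with h | h
      · exact Or.inl h.symm
      refine Or.inr ⟨div_nonneg (hfnn _ (hnonneg x)) h.le, (mul_div_cancel₀ _ h.ne').le, ?_⟩
      generalize u x = t at h
      have hft := hpos t h
      have p1 : 0 ≤ (f t / t) ^ γ := by positivity
      have p2 : 0 ≤ (f t / t) ^ γ' := by positivity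
      suffices t ≤ C₁ * (f t / t) ^ γ + C₂ * (f t / t) ^ γ' + C₃ * (f t / t) ^ γ by
        nlinarith [mul_nonneg hC₁ p2, mul_nonneg hC₂ p1, mul_nonneg hC₃0 p2]
      have q1 := mul_nonneg hC₁ p1
      have q2 := mul_nonneg hC₂ p2
      have q3 := mul_nonneg hC₃0 p1
      rcases le_total t s with hts | hts
      · linarith [h₁ t h hts]
      rcases le_total M t with htM | htM
      · linarith [h₂ t htM]
      have h3 : (f s / M) ^ γ ≤ (f t / t) ^ γ := by
        refine Real.rpow_le_rpow he.le ?_ hγ0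
        exact div_le_div₀ hft.le (hmono hs.le h.le hts) h htM
      have h4 : M ≤ C₃ * (f t / t) ^ γ := by
        rw [hC₃, div_mul_eq_mul_div, le_div_iff₀ (by positivity)]
        exact mul_le_mul_of_nonneg_left h3 hM.le
      linarith
    · rw [one_mul]
      exact integral_solution_le hu hnonneg hsol hζ hζc
  intro x
  by_contra hx
  exact (hpos _ (lt_of_le_of_ne (hnonneg x) (Ne.symm hx))).ne' (hk x)

/-- Liouville theorem for stable solutions when `f' ^ 2 / (f f'')` is controlled near zero. -/
theorem eq_zero_of_stable {N : ℕ} {f h : ℝ → ℝ} {β δ q s M Q : ℝ}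
    (hf : ∀ t, 0 < t → HasDerivAt f (deriv f t) t)
    (hg : ∀ t, 0 < t → HasDerivAt (deriv f) (h t) t)
    (hf0 : f 0 = 0) (hflim : Tendsto f (𝓝[>] 0) (𝓝 0))
    (hfpos : ∀ t, 0 < t → 0 < f t) (hgpos : ∀ t, 0 < t → 0 < deriv f t)
    (hh : ∀ t, 0 < t → 0 ≤ h t)
    (hβ : 0 < β) (hδ : 0 < δ) (hs : 0 < s) (hsM : s ≤ M) (hq0 : 0 < q)
    (hQ : (1 + β) * q ≤ Q)
    (hβs : ∀ t, 0 < t → t ≤ s → (β ^ 2 + δ) * deriv f t ^ 2 ≤ f t * h t)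
    (hqs : ∀ t, 0 < t → t ≤ s → q * (f t * h t) ≤ deriv f t ^ 2)
    (hQM : ∀ t, M ≤ t → deriv f t ^ 2 ≤ Q * (f t * h t))
    (hN : (N : ℝ) < 2 * (2 * (1 + β) * q) + 2)
    {u : EuclideanSpace ℝ (Fin N) → ℝ} (hu : ContDiff ℝ 2 u) (hnonneg : ∀ x, 0 ≤ u x)
    (hsol : ∀ x, -lap u x = f (u x)) (hstab : Stable (deriv f) u) : ∀ x, u x = 0 := by
  have hQ0 : 0 < Q := lt_of_lt_of_le (by positivity) hQ
  obtain ⟨φ, φ', ψ, H, c, K, hc, hK, hφ, hφ', hψ, hH, hφ0, hφpos, hgφ, hfψ, hHφ, hφg⟩ :=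
    exists_test_function hf hg hf0 hflim hfpos hgpos hh hβ hδ hs hsM hq0 hQ0 hβs hqs hQM
  have hφc : Continuous φ := continuous_iff_continuousAt.2 fun t => (hφ t).continuousAt
  have hgu : Continuous fun x => deriv f (u x) * φ (u x) ^ 2 := hgφ.comp hu.continuous
  have hk : ∀ x, deriv f (u x) * φ (u x) ^ 2 = 0 := by
    refine eq_zero_of_cutoff_estimate (a := fun x => φ (u x) ^ 2) (b := fun x => deriv f (u x))
      ((hφc.comp hu.continuous).pow 2) hgu (fun x => sq_nonneg _) (fun x => ?_) hN
      (by positivity) (γ' := 2 * Q) (by linarith) hK (fun x => ?_) (C₀ := c⁻¹) (by positivity)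
      fun ζ hζ hζc => ?_
    · rcases (hnonneg x).eq_or_lt with h | h
      · simp [← h, hφ0]
      · exact mul_nonneg (hgpos _ h).le (sq_nonneg _)
    · rcases (hnonneg x).eq_or_lt with h | h
      · left; simp [← h, hφ0]
      · exact Or.inr ⟨(hgpos _ h).le, (mul_comm _ _).le, hφg _ h⟩
    · rw [le_inv_mul_iff₀ hc]
      exact integral_stable_le hu hsol hstab hφ hφ' hψ hH hgu (fun x => hfψ _ (hnonneg x))
        (fun x => hHφ _ (hnonneg x)) hζ hζc
  intro x
  by_contra hx
  have hx0 := lt_of_le_of_ne (hnonneg x) (Ne.symm hx)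
  exact (mul_pos (hgpos _ hx0) (pow_pos (hφpos _ hx0) 2)).ne' (hk x)

theorem exists_exponents {N : ℕ} {x : ℝ} (hx : 0 < x)
    (hN : (N : ℝ) < 4 * x + 4 * Real.sqrt x + 2) :
    ∃ β δ q : ℝ, 0 < β ∧ 0 < δ ∧ 0 < q ∧ q < x ∧ x < 1 / (β ^ 2 + δ) ∧
      (N : ℝ) < 2 * (2 * (1 + β) * q) + 2 := by
  set y := Real.sqrt x with hy
  have hy0 : 0 < y := Real.sqrt_pos.2 hx
  have hyx : y ^ 2 = x := Real.sq_sqrt hx.le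
  have hcont : Continuous fun θ : ℝ => 2 * (2 * (1 + θ / y) * (θ * x)) + 2 := by fun_prop
  have h1 : (N : ℝ) < 2 * (2 * (1 + 1 / y) * (1 * x)) + 2 := by
    have : 2 * (2 * (1 + 1 / y) * (1 * x)) + 2 = 4 * x + 4 * y + 2 := by
      rw [← hyx]; field_simp; ring
    rwa [this]
  have h2 : ∀ᶠ θ : ℝ in 𝓝[<] 1, (N : ℝ) < 2 * (2 * (1 + θ / y) * (θ * x)) + 2 :=
    (hcont.continuousAt.eventually (lt_mem_nhds h1)).filter_mono nhdsWithin_le_nhds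
  obtain ⟨θ, hθN, hθ0, hθ1⟩ := (h2.and (Ioo_mem_nhdsLT one_pos)).exists
  refine ⟨θ / y, (θ - θ ^ 2) / x, θ * x, by positivity, div_pos (by nlinarith) hx, by positivity,
    by nlinarith, ?_, hθN⟩
  have : (θ / y) ^ 2 + (θ - θ ^ 2) / x = θ / x := by rw [div_pow, hyx]; ring
  rw [this, one_div_div, lt_div_iff₀ hθ0]
  nlinarith

theorem lt_of_lt_pc {N : ℕ} (hN : 11 ≤ N) {p x : ℝ} (hp : 0 < p) (hx : 0 < x)
    (hpx : 1 / p + 1 / x = 1) (hpc : p < pc N) : (N : ℝ) < 4 * x + 4 * Real.sqrt x + 2 := by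
  have hN' : (11 : ℝ) ≤ N := by exact_mod_cast hN
  set r := Real.sqrt ((N : ℝ) - 1) with hr
  have hr2 : r ^ 2 = N - 1 := Real.sq_sqrt (by linarith)
  have hr3 : 3 < r := by
    rw [hr]; exact Real.lt_sqrt_of_sq_lt (by linarith)
  have hpc' : pc N = (r - 1) ^ 2 / ((r + 1) * (r - 3)) := by
    have hNr : (N : ℝ) = r ^ 2 + 1 := by linarith
    rw [pc, ← hr, hNr, div_eq_div_iff (by nlinarith) (by nlinarith)]
    ring
  have hd : 0 < (r + 1) * (r - 3) := mul_pos (by linarith) (by linarith)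
  rw [hpc', lt_div_iff₀ hd] at hpc
  have hpx' : x + p = p * x := by field_simp at hpx; linarith
  have hx1 : 1 < x := by
    by_contra hcon
    nlinarith
  have hpeq : p * (x - 1) = x := by linarith
  have h4 : (r - 1) ^ 2 < 4 * x := by nlinarith
  have hy2 : Real.sqrt x ^ 2 = x := Real.sq_sqrt hx.le
  have hy0 := Real.sqrt_nonneg x
  have h5 : r - 1 < 2 * Real.sqrt x := by
    refine lt_of_pow_lt_pow_left₀ 2 (by positivity) ?_
    rw [mul_pow, hy2]; linarith
  nlinarith

theorem le_sq_of_ofReal_lt_qfun {f : ℝ → ℝ} {t r : ℝ} (h0 : 0 ≤ f t * deriv (deriv f) t)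
    (h : ENNReal.ofReal r < qfun f t) : r * (f t * deriv (deriv f) t) ≤ deriv f t ^ 2 := by
  rcases h0.eq_or_lt with h1 | h1
  · rw [← h1, mul_zero]; positivity
  rw [qfun, if_neg h1.ne'] at h
  have h2 := (ENNReal.ofReal_lt_ofReal_iff').1 h
  exact ((lt_div_iff₀ h1).1 h2.1).le

theorem sq_le_of_qfun_lt {f : ℝ → ℝ} {t R : ℝ} (h0 : 0 ≤ f t * deriv (deriv f) t)
    (h : qfun f t < ENNReal.ofReal R) :
    0 < f t * deriv (deriv f) t ∧ deriv f t ^ 2 ≤ R * (f t * deriv (deriv f) t) := by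
  rcases h0.eq_or_lt with h1 | h1
  · rw [qfun, if_pos h1.symm] at h
    exact absurd h (not_lt.2 le_top)
  rw [qfun, if_neg h1.ne'] at h
  have h2 := (ENNReal.ofReal_lt_ofReal_iff').1 h
  exact ⟨h1, ((div_lt_iff₀ h1).1 h2.1).le⟩

theorem lt_of_conjugate_condition {N : ℕ} {p₀ q₀ : ℝ≥0∞} (hpq : 1 / p₀ + 1 / q₀ = 1)
    (hq : q₀ ≠ ⊤)
    (hdim : N ≤ 9 ∨ (N = 10 ∧ p₀ < ⊤) ∨ (11 ≤ N ∧ p₀ < ENNReal.ofReal (pc N))) :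
    0 < q₀.toReal ∧ (N : ℝ) < 4 * q₀.toReal + 4 * Real.sqrt q₀.toReal + 2 := by
  have hq0 : q₀ ≠ 0 := by
    rintro rfl
    simp at hpq
  have hp0 : p₀ ≠ 0 := by
    rintro rfl
    simp at hpq
  have hx := ENNReal.toReal_pos hq0 hq
  have hreal : 1 / p₀.toReal + 1 / q₀.toReal = 1 := by
    have := congrArg ENNReal.toReal hpq
    rwa [ENNReal.toReal_add (by simp [hp0]) (by simp [hq0]), ENNReal.toReal_div,
      ENNReal.toReal_div, ENNReal.toReal_one] at this
  refine ⟨hx, ?_⟩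
  set x := q₀.toReal
  have hx1 : 1 ≤ x := by
    have h1 : 0 ≤ 1 / p₀.toReal := by positivity
    have h2 : 1 / x ≤ 1 := by linarith
    rwa [div_le_one hx] at h2
  have hs1 : 1 ≤ Real.sqrt x := by simpa using Real.sqrt_le_sqrt hx1
  rcases hdim with hN | ⟨hN, hp⟩ | ⟨hN, hp⟩
  · have : (N : ℝ) ≤ 9 := by exact_mod_cast hN
    linarith
  · have h1 : 0 < 1 / p₀.toReal := one_div_pos.2 (ENNReal.toReal_pos hp0 hp.ne)
    have h2 : 1 / x < 1 := by linarith
    rw [div_lt_one hx] at h2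
    rw [hN]
    push_cast
    linarith
  · have hp' := hp.trans ENNReal.ofReal_lt_top
    exact lt_of_lt_pc hN (ENNReal.toReal_pos hp0 hp'.ne) hx hreal
      ((ENNReal.lt_ofReal_iff_toReal_lt hp'.ne).1 hp)

theorem ne_top_of_one_lt_conjugate {p q : ℝ≥0∞} (hpq : 1 / p + 1 / q = 1) (hp : 1 < p) :
    q ≠ ⊤ := by
  rintro rfl
  simp only [one_div, ENNReal.inv_top, add_zero, ENNReal.inv_eq_one] at hpq
  exact hp.ne' hpq

/-- Corollary 1.7: Liouville theorem for (possibly unbounded) nonnegative stable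
solutions, under an additional control of `q` at `+∞`. -/
theorem stmt3 {N : ℕ} (hN : 1 ≤ N) (f : ℝ → ℝ)
    (hcont : ContinuousOn f (Set.Ici 0)) (hC2 : ContDiffOn ℝ 2 f (Set.Ioi 0))
    (hconv : ConvexOn ℝ (Set.Ioi 0) f) (hmono : MonotoneOn f (Set.Ici 0))
    (hpos : ∀ t : ℝ, 0 < t → 0 < f t)
    (q₀ p₀ : ℝ≥0∞) (hq : Tendsto (qfun f) (𝓝[>] (0:ℝ)) (𝓝 q₀))
    (hpq : 1 / p₀ + 1 / q₀ = 1)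
    (qinf pinf : ℝ≥0∞) (hqinf : qinf = Filter.limsup (qfun f) Filter.atTop)
    (hpinf : 1 / pinf + 1 / qinf = 1)
    (u : EuclideanSpace ℝ (Fin N) → ℝ) (hu : ContDiff ℝ 2 u)
    (hnonneg : ∀ x, 0 ≤ u x)
    (hsol : ∀ x, -lap u x = f (u x)) (hstab : Stable (deriv f) u)
    (hdim : (N ≤ 9 ∧ 1 < pinf) ∨
      (N = 10 ∧ p₀ < ⊤ ∧ 1 < pinf ∧ pinf < ⊤) ∨
      (11 ≤ N ∧ p₀ < ENNReal.ofReal (pc N) ∧ 1 < pinf ∧ pinf < ENNReal.ofReal (pc N))) :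
    ∀ x, u x = 0 := by
  have hpinf1 : 1 < pinf := by tauto
  have hdim' : N ≤ 9 ∨ (N = 10 ∧ p₀ < ⊤) ∨ (11 ≤ N ∧ p₀ < ENNReal.ofReal (pc N)) := by tauto
  have hfd : DifferentiableOn ℝ f (Set.Ioi 0) := hC2.differentiableOn (by norm_num)
  have hf : ∀ t, 0 < t → HasDerivAt f (deriv f t) t := fun t ht =>
    (hfd.differentiableAt (Ioi_mem_nhds ht)).hasDerivAt
  have hgd : DifferentiableOn ℝ (deriv f) (Set.Ioi 0) :=
    (hC2.deriv_of_isOpen isOpen_Ioi (m := 1) (by norm_num)).differentiableOn (by norm_num)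
  have hg : ∀ t, 0 < t → HasDerivAt (deriv f) (deriv (deriv f) t) t := fun t ht =>
    (hgd.differentiableAt (Ioi_mem_nhds ht)).hasDerivAt
  have hgmono : MonotoneOn (deriv f) (Set.Ioi 0) :=
    hconv.monotoneOn_deriv fun t ht => (hf t ht).differentiableAt
  have hh : ∀ t, 0 < t → 0 ≤ deriv (deriv f) t := fun t ht => by
    rw [← derivWithin_of_isOpen isOpen_Ioi ht]
    exact hgmono.derivWithin_nonneg
  have hgnn : ∀ t, 0 < t → 0 ≤ deriv f t := fun t ht => by
    rw [← derivWithin_of_isOpen isOpen_Ioi ht]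
    exact (hmono.mono Set.Ioi_subset_Ici_self).derivWithin_nonneg
  have hfh : ∀ t, 0 < t → 0 ≤ f t * deriv (deriv f) t := fun t ht =>
    mul_nonneg (hpos t ht).le (hh t ht)
  have hflim : Tendsto f (𝓝[>] 0) (𝓝 (f 0)) :=
    (hcont 0 Set.self_mem_Ici).mono_left (nhdsWithin_mono 0 Set.Ioi_subset_Ici_self)
  have hf0 : 0 ≤ f 0 := ge_of_tendsto hflim (by
    filter_upwards [self_mem_nhdsWithin] with t ht using (hpos t ht).le)
  have hqtop : Filter.limsup (qfun f) Filter.atTop < ⊤ :=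
    hqinf ▸ (ne_top_of_one_lt_conjugate hpinf hpinf1).lt_top
  obtain ⟨B, hB1, hB2⟩ := exists_between hqtop
  obtain ⟨M₀, hM₀⟩ := eventually_atTop.1 (eventually_lt_of_limsup_lt hB1)
  have hinf : ∀ t, max M₀ 1 ≤ t → 0 < f t * deriv (deriv f) t ∧
      deriv f t ^ 2 ≤ B.toReal * (f t * deriv (deriv f) t) := fun t ht => by
    refine sq_le_of_qfun_lt (hfh t (by linarith [(le_max_right M₀ 1).trans ht])) ?_
    rw [ENNReal.ofReal_toReal hB2.ne]
    exact hM₀ t ((le_max_left _ _).trans ht)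
  set M := max M₀ 1 + 1 with hM
  have hM1 : 1 < M := by linarith [le_max_right M₀ 1]
  have hgM : 0 < deriv f M := by
    have hlt : StrictMonoOn (deriv f) (Set.Ici (max M₀ 1)) :=
      strictMonoOn_of_deriv_pos (convex_Ici _)
        (hgd.continuousOn.mono fun t ht => lt_of_lt_of_le one_pos ((le_max_right M₀ 1).trans ht))
        fun t ht => pos_of_mul_pos_right (hinf t (interior_subset ht)).1
          (hpos t (lt_of_lt_of_le one_pos ((le_max_right M₀ 1).trans (interior_subset ht)))).le
    have h1 := hlt Set.self_mem_Ici (Set.mem_Ici.2 (by linarith)) (show max M₀ 1 < M by linarith)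
    linarith [hgnn (max M₀ 1) (lt_of_lt_of_le one_pos (le_max_right M₀ 1))]
  have hinfQ : ∀ Q, B.toReal ≤ Q → ∀ t, M ≤ t →
      deriv f t ^ 2 ≤ Q * (f t * deriv (deriv f) t) := fun Q hQ t ht => by
    obtain ⟨h1, h2⟩ := hinf t (by linarith)
    nlinarith
  have hB0 : 0 ≤ B.toReal := ENNReal.toReal_nonneg
  have hcaseA : (∃ s C₁ : ℝ, 0 < s ∧ 0 ≤ C₁ ∧
      ∀ t, 0 < t → t ≤ s → t ≤ C₁ * (f t / t) ^ ((N : ℝ) + 1)) → ∀ x, u x = 0 := by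
    rintro ⟨s, C₁, hs, hC₁, h₁⟩
    have hN0 : (0 : ℝ) ≤ N := N.cast_nonneg
    set Q : ℝ := B.toReal + N + 2 with hQ
    obtain ⟨C₂, hC₂, h₂⟩ := exists_le_mul_div_rpow_atTop (Q := Q) (by linarith) (by linarith)
      hf hg hpos hgM (hinfQ Q (by linarith))
    exact eq_zero_of_le_mul_div_rpow hcont hmono hpos hf0 hu hnonneg hsol hs (by linarith) hC₁ hC₂
      (by positivity) (show (N : ℝ) + 1 ≤ Q - 1 by linarith) (by linarith) h₁ h₂
  rcases hf0.eq_or_lt with hf00 | hf00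
  swap
  · refine hcaseA ⟨1, (f 0 ^ ((N : ℝ) + 1))⁻¹, one_pos, by positivity, fun t ht ht1 => ?_⟩
    refine ht1.trans ?_
    rw [le_inv_mul_iff₀ (by positivity), mul_one]
    refine Real.rpow_le_rpow hf00.le ?_ (by positivity)
    rw [le_div_iff₀ ht]
    have := hmono Set.self_mem_Ici (Set.mem_Ici.2 ht.le) ht.le
    nlinarith
  have hgpos : ∀ t, 0 < t → 0 < deriv f t := fun t ht => by
    obtain ⟨c, hc, hslope⟩ := exists_hasDerivAt_eq_slope f (deriv f) ht
      (hcont.mono Set.Icc_subset_Ici_self) fun y hy => hf y hy.1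
    rw [← hf00, sub_zero, sub_zero] at hslope
    exact (hslope ▸ div_pos (hpos t ht) ht : 0 < deriv f c).trans_le (hgmono hc.1 ht hc.2.le)
  have hlow : ∀ r : ℝ, ENNReal.ofReal r < q₀ → ∀ᶠ t in 𝓝[>] (0 : ℝ),
      r * (f t * deriv (deriv f) t) ≤ deriv f t ^ 2 := fun r hr => by
    filter_upwards [hq.eventually (lt_mem_nhds hr), self_mem_nhdsWithin] with t ht ht0
    exact le_sq_of_ofReal_lt_qfun (hfh t ht0) ht
  by_cases hq₀ : q₀ = ⊤
  · obtain ⟨s, hs, hsub⟩ := mem_nhdsGT_iff_exists_Ioc_subset.1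
      (hlow ((N : ℝ) + 2) (hq₀ ▸ ENNReal.ofReal_lt_top))
    have hN0 : (0 : ℝ) ≤ N := N.cast_nonneg
    obtain ⟨C₁, hC₁, h₁⟩ := exists_le_mul_div_rpow_zero hs (by linarith : 1 < (N : ℝ) + 2) hf hg
      hpos (hgpos s hs) fun t ht hts => hsub ⟨ht, hts⟩
    rw [show (N : ℝ) + 2 - 1 = N + 1 by ring] at h₁
    exact hcaseA ⟨s, C₁, hs, hC₁, h₁⟩
  obtain ⟨hx, hNx⟩ := lt_of_conjugate_condition hpq hq₀ hdim'
  obtain ⟨β, δ, q, hβ, hδ, hq0, hqx, hxβ, hNβ⟩ := exists_exponents hx hNx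
  have hup : ∀ᶠ t in 𝓝[>] (0 : ℝ),
      (β ^ 2 + δ) * deriv f t ^ 2 ≤ f t * deriv (deriv f) t := by
    have hR : q₀ < ENNReal.ofReal (1 / (β ^ 2 + δ)) :=
      (ENNReal.lt_ofReal_iff_toReal_lt hq₀).2 hxβ
    filter_upwards [hq.eventually (gt_mem_nhds hR), self_mem_nhdsWithin] with t ht ht0
    have h1 := (sq_le_of_qfun_lt (hfh t ht0) ht).2
    rwa [one_div, le_inv_mul_iff₀ (by positivity)] at h1
  obtain ⟨s, hs, hsub⟩ := mem_nhdsGT_iff_exists_Ioc_subset.1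
    (hup.and (hlow q ((ENNReal.ofReal_lt_iff_lt_toReal hq0.le hq₀).2 hqx)))
  refine eq_zero_of_stable (M := max M s) (Q := max B.toReal ((1 + β) * q)) hf hg hf00.symm
    (by rwa [← hf00] at hflim) hpos hgpos hh hβ hδ hs (le_max_right _ _) hq0 (le_max_right _ _)
    (fun t ht hts => (hsub ⟨ht, hts⟩).1) (fun t ht hts => (hsub ⟨ht, hts⟩).2)
    (fun t ht => hinfQ _ (le_max_left _ _) t ((le_max_left _ _).trans ht)) hNβ hu hnonneg hsol hstab
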